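/- arXiv:2208.04923 — 4 statements merged into one kernel-verified Lean document; each statement's English description precedes it below -/
import Mathlib

section
/- Let U ⊆ ℝⁿ be open, λ ∈ (0,1] and σ > 0. Let Λ_ε ⊆ U be relatively closed in U and let w_ε : U → ℝ be continuous with w_ε ≥ −σ² in U, w_ε ≤ 0 on Λ_ε, and Δw_ε ≥ λ weakly in U ∖ Λ_ε. Let w₀ : U → ℝ be continuous with w₀ ≥ 0 in U, set Λ₀ := {x ∈ U : w₀(x) = 0} and Γ₀ := ∂Λ₀ ∩ U, and assume: (sandwich) w₀ − σ² ≤ w_ε ≤ w₀ in U; (strong non-degeneracy) there is c₁ > 0 such that w₀(x) ≥ c₁ dist(x, Γ₀)² for every x ∈ U with w₀(x) > 0. Let L := 4(2n/λ)^{1/2}σ, let Λ̃_ε be the union of all closed cubes L(k + [0,1]ⁿ), k ∈ ℤⁿ, intersecting Λ_ε, and Γ̃_ε := ∂Λ̃_ε ∩ U. Then there exists C > 0 depending only on n, λ and c₁ such that every x ∈ Γ̃_ε with cl(B_{dist(x,Γ₀) + √n·L}(x)) ⊆ U satisfies dist(x, Γ₀) ≤ C σ. -/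
open MeasureTheory Metric Set

/-- The (pointwise) Laplacian of a smooth `f : ℝⁿ → ℝ`. -/
noncomputable def lapl (n : ℕ) (f : EuclideanSpace ℝ (Fin n) → ℝ)
    (x : EuclideanSpace ℝ (Fin n)) : ℝ :=
  ∑ i : Fin n, fderiv ℝ (fun y => fderiv ℝ f y (EuclideanSpace.single i 1)) x
    (EuclideanSpace.single i 1)

/-- `Δw ≥ c` weakly in `V`. -/
def LapGeWeak (n : ℕ) (V : Set (EuclideanSpace ℝ (Fin n)))
    (w : EuclideanSpace ℝ (Fin n) → ℝ) (c : ℝ) : Prop :=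
  ∀ φ : EuclideanSpace ℝ (Fin n) → ℝ, ContDiff ℝ (⊤ : ℕ∞) φ → HasCompactSupport φ →
    tsupport φ ⊆ V → (∀ x, 0 ≤ φ x) →
    c * ∫ x in V, φ x ≤ ∫ x in V, w x * lapl n φ x

/-- The closed lattice cube `L(k + [0,1]ⁿ)` for `k ∈ ℤⁿ`. -/
def latticeCube (n : ℕ) (L : ℝ) (k : Fin n → ℤ) : Set (EuclideanSpace ℝ (Fin n)) :=
  {x | ∀ i, L * (k i : ℝ) ≤ x i ∧ x i ≤ L * (k i : ℝ) + L}

/-- The bulk set: the union of all closed lattice cubes of side `L` meeting `Λ`. -/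
def bulkSet (n : ℕ) (L : ℝ) (Λ : Set (EuclideanSpace ℝ (Fin n))) :
    Set (EuclideanSpace ℝ (Fin n)) :=
  ⋃ (k : Fin n → ℤ) (_ : (latticeCube n L k ∩ Λ).Nonempty), latticeCube n L k

/-- A smooth increasing step from `0` to `1`, constant outside `[-1/20, 1/20]`. -/
noncomputable def smoothStep (x : ℝ) : ℝ := Real.smoothTransition (10 * x + 1 / 2)

/-- The primitive of `smoothStep` vanishing on `(-∞, -1/20]`. -/
noncomputable def smoothRamp (x : ℝ) : ℝ := ∫ t in (-1)..x, smoothStep t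

/-- A smooth approximation of the hat function, supported in `[-1, 1]`. -/
noncomputable def smoothHat (x : ℝ) : ℝ :=
  smoothRamp (x + 19 / 20) - 2 * smoothRamp x + smoothRamp (x - 19 / 20)

lemma smoothStep_contDiff : ContDiff ℝ (⊤ : ℕ∞) smoothStep :=
  Real.smoothTransition.contDiff.comp ((contDiff_const.mul contDiff_id).add contDiff_const)

lemma smoothStep_monotone : Monotone smoothStep := fun x y h =>
  Real.smoothTransition.monotone (by linarith)

lemma smoothStep_eq_zero {x : ℝ} (hx : x ≤ -1 / 20) : smoothStep x = 0 :=
  Real.smoothTransition.zero_of_nonpos (by linarith)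

lemma smoothStep_eq_one {x : ℝ} (hx : 1 / 20 ≤ x) : smoothStep x = 1 :=
  Real.smoothTransition.one_of_one_le (by linarith)

lemma smoothStep_intervalIntegrable (a b : ℝ) : IntervalIntegrable smoothStep volume a b :=
  smoothStep_contDiff.continuous.intervalIntegrable a b

lemma smoothRamp_hasDerivAt (x : ℝ) : HasDerivAt smoothRamp (smoothStep x) x :=
  smoothStep_contDiff.continuous.integral_hasStrictDerivAt (-1) x |>.hasDerivAt

lemma smoothRamp_deriv : deriv smoothRamp = smoothStep :=
  funext fun x => (smoothRamp_hasDerivAt x).deriv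

lemma smoothRamp_contDiff : ContDiff ℝ (⊤ : ℕ∞) smoothRamp :=
  contDiff_infty_iff_deriv.2
    ⟨fun x => (smoothRamp_hasDerivAt x).differentiableAt, smoothRamp_deriv ▸ smoothStep_contDiff⟩

lemma smoothRamp_convexOn : ConvexOn ℝ univ smoothRamp :=
  Monotone.convexOn_univ_of_deriv (fun x => (smoothRamp_hasDerivAt x).differentiableAt)
    (smoothRamp_deriv ▸ smoothStep_monotone)

lemma smoothRamp_sub (a b : ℝ) : smoothRamp b - smoothRamp a = ∫ t in a..b, smoothStep t :=
  intervalIntegral.integral_interval_sub_left (smoothStep_intervalIntegrable _ _)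
    (smoothStep_intervalIntegrable _ _)

lemma smoothRamp_eq_zero {x : ℝ} (hx : x ≤ -1 / 20) : smoothRamp x = 0 := by
  unfold smoothRamp
  rw [intervalIntegral.integral_congr (g := fun _ => 0), intervalIntegral.integral_zero]
  intro t ht
  exact smoothStep_eq_zero (ht.2.trans (sup_le (by norm_num) hx))

lemma smoothRamp_mono : Monotone smoothRamp :=
  monotone_of_deriv_nonneg (fun x => (smoothRamp_hasDerivAt x).differentiableAt) fun x => by
    rw [smoothRamp_deriv]; exact Real.smoothTransition.nonneg _

lemma smoothRamp_nonneg (x : ℝ) : 0 ≤ smoothRamp x := by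
  rcases le_total x (-1 / 20) with h | h
  · rw [smoothRamp_eq_zero h]
  · simpa [smoothRamp_eq_zero le_rfl] using smoothRamp_mono h

lemma smoothRamp_sub_of_le {x y : ℝ} (hx : 1 / 20 ≤ x) (hy : 1 / 20 ≤ y) :
    smoothRamp y - smoothRamp x = y - x := by
  rw [smoothRamp_sub, intervalIntegral.integral_congr (g := fun _ => (1 : ℝ))]
  · simp
  intro t ht
  exact smoothStep_eq_one ((le_inf hx hy).trans ht.1)

lemma smoothRamp_le {x : ℝ} (hx : -1 / 20 ≤ x) : smoothRamp x ≤ x + 1 / 20 := by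
  have h : smoothRamp x - smoothRamp (-1 / 20) ≤ ∫ _ in (-1 / 20)..x, (1 : ℝ) := by
    rw [smoothRamp_sub]
    exact intervalIntegral.integral_mono hx (smoothStep_intervalIntegrable _ _)
      intervalIntegrable_const fun t => Real.smoothTransition.le_one _
  rw [smoothRamp_eq_zero le_rfl, intervalIntegral.integral_const] at h
  simp at h; linarith

lemma le_smoothRamp (x : ℝ) : x - 1 / 20 ≤ smoothRamp x := by
  rcases le_total x (1 / 20) with h | h
  · exact le_trans (by linarith) (smoothRamp_nonneg x)
  · linarith [smoothRamp_sub_of_le le_rfl h, smoothRamp_nonneg (1 / 20)]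

lemma smoothHat_contDiff : ContDiff ℝ (⊤ : ℕ∞) smoothHat :=
  ((smoothRamp_contDiff.comp (contDiff_id.add contDiff_const)).sub
    (contDiff_const.mul smoothRamp_contDiff)).add
    (smoothRamp_contDiff.comp (contDiff_id.sub contDiff_const))

lemma smoothHat_deriv : deriv smoothHat = fun x =>
    smoothStep (x + 19 / 20) - 2 * smoothStep x + smoothStep (x - 19 / 20) :=
  funext fun x => ((((smoothRamp_hasDerivAt _).comp_add_const x _).sub
    ((smoothRamp_hasDerivAt x).const_mul 2)).add
      ((smoothRamp_hasDerivAt _).comp_sub_const x _)).deriv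

lemma smoothStep_deriv_nonneg (x : ℝ) : 0 ≤ deriv smoothStep x := smoothStep_monotone.deriv_nonneg

lemma smoothHat_deriv_deriv (x : ℝ) : -(2 * deriv smoothStep x) ≤ deriv (deriv smoothHat) x := by
  have h (y : ℝ) : HasDerivAt smoothStep (deriv smoothStep y) y :=
    (smoothStep_contDiff.differentiable (by simp) y).hasDerivAt
  have h' := ((((h _).comp_add_const x (19 / 20)).sub ((h x).const_mul 2)).add
    ((h _).comp_sub_const x (19 / 20))).deriv
  rw [smoothHat_deriv]
  refine le_trans ?_ h'.ge
  linarith [smoothStep_deriv_nonneg (x + 19 / 20), smoothStep_deriv_nonneg (x - 19 / 20)]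

lemma smoothHat_nonneg (x : ℝ) : 0 ≤ smoothHat x := by
  have h := smoothRamp_convexOn.2 (mem_univ (x + 19 / 20)) (mem_univ (x - 19 / 20))
    (show (0 : ℝ) ≤ 1 / 2 by norm_num) (show (0 : ℝ) ≤ 1 / 2 by norm_num) (by norm_num)
  simp only [smul_eq_mul] at h
  rw [show 1 / 2 * (x + 19 / 20) + 1 / 2 * (x - 19 / 20) = x by ring] at h
  unfold smoothHat
  linarith

lemma smoothHat_eq_zero {x : ℝ} (hx : 1 ≤ |x|) : smoothHat x = 0 := by
  unfold smoothHat
  rcases le_abs.1 hx with h | h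
  · have h₁ := smoothRamp_sub_of_le (x := x) (y := x + 19 / 20) (by linarith) (by linarith)
    have h₂ := smoothRamp_sub_of_le (x := x) (y := x - 19 / 20) (by linarith) (by linarith)
    linarith
  · rw [smoothRamp_eq_zero (by linarith), smoothRamp_eq_zero (by linarith),
      smoothRamp_eq_zero (by linarith)]
    simp

lemma smoothHat_support_subset : Function.support smoothHat ⊆ Icc (-1) 1 := fun x hx => by
  refine abs_le.1 ?_
  by_contra! h
  exact hx (smoothHat_eq_zero h.le)

lemma smoothHat_integrable : Integrable smoothHat :=
  smoothHat_contDiff.continuous.integrable_of_hasCompactSupport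
    (HasCompactSupport.of_support_subset_isCompact isCompact_Icc smoothHat_support_subset)

lemma le_smoothHat {x : ℝ} (hx : x ∈ Icc (-1 / 2 : ℝ) (1 / 2)) : 3 / 10 ≤ smoothHat x := by
  obtain ⟨h₁, h₂⟩ := hx
  unfold smoothHat
  have := le_smoothRamp (x + 19 / 20)
  have := smoothRamp_nonneg (x - 19 / 20)
  rcases le_total x (-1 / 20) with h | h
  · linarith [smoothRamp_eq_zero h]
  · linarith [smoothRamp_le h]

lemma le_integral_smoothHat : 3 / 10 ≤ ∫ x, smoothHat x := by
  have h : ∫ _ in Icc (-1 / 2 : ℝ) (1 / 2), (3 / 10 : ℝ) ≤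
      ∫ x in Icc (-1 / 2 : ℝ) (1 / 2), smoothHat x :=
    setIntegral_mono_on (by simp) smoothHat_integrable.integrableOn measurableSet_Icc
      fun x hx => le_smoothHat hx
  refine le_trans ?_ (h.trans (setIntegral_le_integral smoothHat_integrable
    (Filter.Eventually.of_forall smoothHat_nonneg)))
  norm_num

lemma smoothStep_deriv_hasCompactSupport : HasCompactSupport (deriv smoothStep) := by
  refine HasCompactSupport.of_support_subset_isCompact
    (isCompact_Icc (a := -1) (b := 1)) fun x hx => ?_
  by_contra h
  rw [mem_Icc, not_and_or, not_le, not_le] at h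
  refine hx ?_
  rcases h with h | h
  · have h' : smoothStep =ᶠ[nhds x] fun _ => 0 := (eventually_lt_nhds h).mono fun y hy =>
      smoothStep_eq_zero (by linarith)
    rw [h'.deriv_eq, deriv_const]
  · have h' : smoothStep =ᶠ[nhds x] fun _ => 1 := (eventually_gt_nhds h).mono fun y hy =>
      smoothStep_eq_one (by linarith)
    rw [h'.deriv_eq, deriv_const]

lemma smoothStep_deriv_integrable : Integrable (deriv smoothStep) :=
  (smoothStep_contDiff.continuous_deriv (by simp)).integrable_of_hasCompactSupport
    smoothStep_deriv_hasCompactSupport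

lemma integral_smoothStep_deriv : ∫ x, deriv smoothStep x = 1 := by
  rw [integral_of_hasDerivAt_of_tendsto (f := smoothStep) (m := 0) (n := 1)
    (fun x => (smoothStep_contDiff.differentiable (by simp) x).hasDerivAt)
    smoothStep_deriv_integrable]
  · simp
  · exact tendsto_const_nhds.congr' ((Filter.eventually_le_atBot _).mono
      fun y hy => (smoothStep_eq_zero hy).symm)
  · exact tendsto_const_nhds.congr' ((Filter.eventually_ge_atTop _).mono
      fun y hy => (smoothStep_eq_one hy).symm)

lemma hasFDerivAt_prod_coord {n : ℕ} {f f' : Fin n → ℝ → ℝ}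
    (x : EuclideanSpace ℝ (Fin n)) (h : ∀ j, HasDerivAt (f j) (f' j (x j)) (x j)) :
    HasFDerivAt (fun y : EuclideanSpace ℝ (Fin n) => ∏ j, f j (y j))
      (∑ i, (∏ j ∈ Finset.univ.erase i, f j (x j)) •
        f' i (x i) • (EuclideanSpace.proj i : EuclideanSpace ℝ (Fin n) →L[ℝ] ℝ)) x :=
  HasFDerivAt.finsetProd fun i _ =>
    (h i).comp_hasFDerivAt x (EuclideanSpace.proj i : EuclideanSpace ℝ (Fin n) →L[ℝ] ℝ).hasFDerivAt

lemma fderiv_prod_coord_single {n : ℕ} {f : Fin n → ℝ → ℝ} {g : ℝ → ℝ} (i : Fin n)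
    (hf : ∀ j, Differentiable ℝ (f j)) (hg : deriv (f i) = g) (x : EuclideanSpace ℝ (Fin n)) :
    fderiv ℝ (fun y : EuclideanSpace ℝ (Fin n) => ∏ j, f j (y j)) x
      (EuclideanSpace.single i 1) = ∏ j, Function.update f i g j (x j) := by
  rw [(hasFDerivAt_prod_coord x fun j => (hf j (x j)).hasDerivAt).fderiv,
    ← Finset.mul_prod_erase _ _ (Finset.mem_univ i)]
  simp only [_root_.sum_apply, _root_.smul_apply, PiLp.proj_apply, smul_eq_mul,
    PiLp.single_apply]
  rw [Finset.sum_eq_single i (fun j _ hj => by simp [hj]) (by simp), Function.update_self, hg]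
  simp only [if_true, mul_one]
  rw [mul_comm]
  congr 1
  refine Finset.prod_congr rfl fun j hj => ?_
  rw [Function.update_of_ne (Finset.ne_of_mem_erase hj)]

lemma lapl_prod_coord {n : ℕ} {f f₂ : Fin n → ℝ → ℝ} (hf : ∀ j, ContDiff ℝ (⊤ : ℕ∞) (f j))
    (hf₂ : ∀ j, deriv (deriv (f j)) = f₂ j) (x : EuclideanSpace ℝ (Fin n)) :
    lapl n (fun y => ∏ j, f j (y j)) x =
      ∑ i, ∏ j, Function.update f i (f₂ i) j (x j) := by
  unfold lapl
  refine Finset.sum_congr rfl fun i _ => ?_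
  have h : ∀ j, Differentiable ℝ (f j) := fun j => (hf j).differentiable (by simp)
  have h' : ∀ j, Differentiable ℝ (Function.update f i (deriv (f i)) j) := fun j => by
    rcases eq_or_ne j i with rfl | hj
    · rw [Function.update_self]
      exact (contDiff_infty_iff_deriv.1 (hf j)).2.differentiable (by simp)
    · rw [Function.update_of_ne hj]; exact h j
  simp only [fderiv_prod_coord_single i h rfl]
  rw [fderiv_prod_coord_single i h' (by rw [Function.update_self, hf₂]), Function.update_idem]

lemma integral_prod_coord {n : ℕ} (f : Fin n → ℝ → ℝ) :
    ∫ x : EuclideanSpace ℝ (Fin n), ∏ j, f j (x j) = ∏ j, ∫ t, f j t := by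
  rw [← integral_fintype_prod_volume_eq_prod]
  exact (PiLp.volume_preserving_ofLp (Fin n)).integral_comp
    (MeasurableEquiv.toLp 2 (Fin n → ℝ)).symm.measurableEmbedding fun x => ∏ j, f j (x j)

lemma integrable_prod_coord {n : ℕ} {f : Fin n → ℝ → ℝ} (hf : ∀ j, Integrable (f j)) :
    Integrable fun x : EuclideanSpace ℝ (Fin n) => ∏ j, f j (x j) :=
  (PiLp.volume_preserving_ofLp (Fin n)).integrable_comp_emb
    (MeasurableEquiv.toLp 2 (Fin n → ℝ)).symm.measurableEmbedding |>.2
    (Integrable.fintype_prod hf)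

/-- `smoothHat` rescaled to the interval `[a - r, a + r]`. -/
noncomputable def scaledHat (a r x : ℝ) : ℝ := smoothHat ((x - a) / r)

/-- The rescaling of `2 * deriv smoothStep`, which bounds the negative part of the second
derivative of `scaledHat a r`. -/
noncomputable def scaledHatNeg (a r x : ℝ) : ℝ := 2 * deriv smoothStep ((x - a) / r) / r ^ 2

lemma scaledHat_contDiff (a r : ℝ) : ContDiff ℝ (⊤ : ℕ∞) (scaledHat a r) :=
  smoothHat_contDiff.comp ((contDiff_id.sub contDiff_const).div_const r)

lemma scaledHat_nonneg (a r x : ℝ) : 0 ≤ scaledHat a r x := smoothHat_nonneg _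

lemma scaledHatNeg_nonneg (a r x : ℝ) : 0 ≤ scaledHatNeg a r x :=
  div_nonneg (mul_nonneg zero_le_two (smoothStep_deriv_nonneg _)) (sq_nonneg r)

lemma scaledHat_eq_zero {a r x : ℝ} (hr : 0 < r) (hx : r ≤ |x - a|) : scaledHat a r x = 0 :=
  smoothHat_eq_zero <| by rwa [abs_div, abs_of_pos hr, one_le_div hr]

lemma neg_scaledHatNeg_le (a r x : ℝ) :
    -scaledHatNeg a r x ≤ deriv (deriv (scaledHat a r)) x := by
  have h (f : ℝ → ℝ) (hf : ContDiff ℝ (⊤ : ℕ∞) f) :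
      deriv (fun y => f ((y - a) / r)) = fun y => deriv f ((y - a) / r) / r := by
    funext y
    have := (hf.differentiable (by simp) ((y - a) / r)).hasDerivAt.comp y
      (((hasDerivAt_id y).sub_const a).div_const r)
    exact this.deriv.trans (by simp [div_eq_mul_inv])
  have h₁ : deriv (scaledHat a r) = fun y => deriv smoothHat ((y - a) / r) / r :=
    h _ smoothHat_contDiff
  rw [h₁, deriv_div_const, h _ (contDiff_infty_iff_deriv.1 smoothHat_contDiff).2, scaledHatNeg,
    div_div, ← sq, ← neg_div]
  exact div_le_div_of_nonneg_right (smoothHat_deriv_deriv _) (sq_nonneg r)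

lemma scaledHat_integrable (a : ℝ) {r : ℝ} (hr : 0 < r) : Integrable (scaledHat a r) :=
  (smoothHat_integrable.comp_div hr.ne').comp_sub_right a

lemma scaledHatNeg_integrable (a : ℝ) {r : ℝ} (hr : 0 < r) : Integrable (scaledHatNeg a r) :=
  (((smoothStep_deriv_integrable.comp_div hr.ne').comp_sub_right a).const_mul 2).div_const _

lemma integral_comp_sub_div (f : ℝ → ℝ) (a : ℝ) {r : ℝ} (hr : 0 < r) :
    ∫ x, f ((x - a) / r) = r * ∫ x, f x := by
  rw [integral_sub_right_eq_self (fun x => f (x / r)) a, Measure.integral_comp_div,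
    abs_of_pos hr, smul_eq_mul]

lemma le_integral_scaledHat (a : ℝ) {r : ℝ} (hr : 0 < r) :
    3 / 10 * r ≤ ∫ x, scaledHat a r x := by
  unfold scaledHat
  rw [integral_comp_sub_div _ a hr, mul_comm]
  exact mul_le_mul_of_nonneg_left le_integral_smoothHat hr.le

lemma integral_scaledHatNeg (a : ℝ) {r : ℝ} (hr : 0 < r) :
    ∫ x, scaledHatNeg a r x = 2 / r := by
  unfold scaledHatNeg
  rw [integral_div, integral_const_mul, integral_comp_sub_div _ a hr, integral_smoothStep_deriv]
  field_simp

/-- A weak subsolution of `Δw ≥ c` on a cube of half-side `r` cannot stay between `-m` and `0`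
when `r` is large compared to `√m`. -/
lemma LapGeWeak.mul_sq_lt {n : ℕ} {V : Set (EuclideanSpace ℝ (Fin n))}
    {w : EuclideanSpace ℝ (Fin n) → ℝ} {c m r : ℝ} (h : LapGeWeak n V w c)
    (hc : 0 ≤ c) (hm : 0 < m) (hr : 0 < r) (hn : 0 < n) {a : Fin n → ℝ}
    (hV : {x : EuclideanSpace ℝ (Fin n) | ∀ i, |x i - a i| ≤ r} ⊆ V)
    (hw : ∀ x : EuclideanSpace ℝ (Fin n), (∀ i, |x i - a i| ≤ r) → w x ∈ Icc (-m) 0) :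
    c * r ^ 2 < 8 * n * m := by
  set φ : EuclideanSpace ℝ (Fin n) → ℝ := fun x => ∏ j, scaledHat (a j) r (x j) with hφ
  set N : EuclideanSpace ℝ (Fin n) → ℝ := fun x =>
    ∑ i, ∏ j, Function.update (fun j => scaledHat (a j) r) i (scaledHatNeg (a i) r) j (x j) with hN
  have hsupp : Function.support φ ⊆ {x | ∀ i, |x i - a i| ≤ r} := fun x hx i => by
    by_contra! hi
    exact hx (Finset.prod_eq_zero (Finset.mem_univ i) (scaledHat_eq_zero hr hi.le))
  have hclosed : IsClosed {x : EuclideanSpace ℝ (Fin n) | ∀ i, |x i - a i| ≤ r} := by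
    simp only [ofPred_forall]
    exact isClosed_iInter fun i => isClosed_le (by fun_prop) continuous_const
  have hbdd : Bornology.IsBounded {x : EuclideanSpace ℝ (Fin n) | ∀ i, |x i - a i| ≤ r} := by
    refine (isBounded_iff_subset_closedBall (WithLp.toLp 2 a)).2
      ⟨√(∑ _ : Fin n, r ^ 2), fun x hx => ?_⟩
    rw [mem_closedBall, EuclideanSpace.dist_eq]
    refine Real.sqrt_le_sqrt (Finset.sum_le_sum fun i _ => ?_)
    exact pow_le_pow_left₀ dist_nonneg (hx i) 2
  have hts := closure_minimal hsupp hclosed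
  have hcpt := isCompact_of_isClosed_isBounded hclosed hbdd
  have hupd_nonneg (i j : Fin n) (t : ℝ) : 0 ≤ Function.update (fun j => scaledHat (a j) r) i
      (scaledHatNeg (a i) r) j t := by
    rcases eq_or_ne j i with rfl | hj
    · rw [Function.update_self]; exact scaledHatNeg_nonneg _ _ _
    · rw [Function.update_of_ne hj]; exact scaledHat_nonneg _ _ _
  have hN_nonneg (x) : 0 ≤ N x :=
    Finset.sum_nonneg fun i _ => Finset.prod_nonneg fun j _ => hupd_nonneg i j _
  have hN_int : Integrable N := integrable_finsetSum _ fun i _ => integrable_prod_coord fun j => by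
    rcases eq_or_ne j i with rfl | hj
    · rw [Function.update_self]; exact scaledHatNeg_integrable _ hr
    · rw [Function.update_of_ne hj]; exact scaledHat_integrable _ hr
  have hlap (x) : -N x ≤ lapl n φ x := by
    rw [hφ, lapl_prod_coord (fun j => scaledHat_contDiff _ _) (fun j => rfl), hN,
      ← Finset.sum_neg_distrib]
    refine Finset.sum_le_sum fun i _ => ?_
    rw [← Finset.mul_prod_erase _ _ (Finset.mem_univ i), Function.update_self,
      ← Finset.mul_prod_erase _ _ (Finset.mem_univ i), Function.update_self, ← neg_mul]
    have (g : ℝ → ℝ) : ∏ j ∈ Finset.univ.erase i,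
        Function.update (fun j => scaledHat (a j) r) i g j (x j)
        = ∏ j ∈ Finset.univ.erase i, scaledHat (a j) r (x j) :=
      Finset.prod_congr rfl fun j hj => by rw [Function.update_of_ne (Finset.ne_of_mem_erase hj)]
    rw [this, this]
    exact mul_le_mul_of_nonneg_right (neg_scaledHatNeg_le _ _ _)
      (Finset.prod_nonneg fun j _ => scaledHat_nonneg _ _ _)
  have hlap_zero (x : EuclideanSpace ℝ (Fin n)) (hx : ¬ ∀ i, |x i - a i| ≤ r) : lapl n φ x = 0 := by
    have hev : φ =ᶠ[nhds x] fun _ => 0 := by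
      filter_upwards [hclosed.isOpen_compl.mem_nhds hx] with y hy
      exact Function.notMem_support.1 fun h => hy (hsupp h)
    unfold lapl
    refine Finset.sum_eq_zero fun i _ => ?_
    have hev' : (fun y => fderiv ℝ φ y (EuclideanSpace.single i 1)) =ᶠ[nhds x] fun _ => 0 := by
      filter_upwards [hev.fderiv (𝕜 := ℝ)] with y hy
      rw [hy]; simp
    rw [hev'.fderiv_eq]; simp
  have hle (x) : w x * lapl n φ x ≤ m * N x := by
    by_cases hx : ∀ i, |x i - a i| ≤ r
    · obtain ⟨h₁, h₂⟩ := hw x hx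
      nlinarith [hlap x, hN_nonneg x]
    · rw [hlap_zero x hx, mul_zero]
      exact mul_nonneg hm.le (hN_nonneg x)
  have hint : ∫ x in V, w x * lapl n φ x ≤ m * ∫ x, N x := by
    rw [← integral_const_mul]
    have hmN : 0 ≤ᵐ[volume] fun x => m * N x :=
      Filter.Eventually.of_forall fun x => mul_nonneg hm.le (hN_nonneg x)
    refine le_trans ?_ (setIntegral_le_integral (s := V) (hN_int.const_mul m) hmN)
    by_cases hi : IntegrableOn (fun x => w x * lapl n φ x) V
    · exact integral_mono hi (hN_int.const_mul m).integrableOn hle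
    · rw [integral_undef hi]
      exact integral_nonneg fun x => mul_nonneg hm.le (hN_nonneg x)
  have hφV : ∫ x in V, φ x = ∏ j, ∫ t, scaledHat (a j) r t := by
    rw [setIntegral_eq_integral_of_forall_compl_eq_zero, hφ,
      integral_prod_coord fun j => scaledHat (a j) r]
    exact fun x hx => Function.notMem_support.1 fun h => hx (hV (hsupp h))
  have hI : ∀ j, ∫ t, scaledHat (a j) r t = r * ∫ t, smoothHat t := fun j =>
    integral_comp_sub_div _ _ hr
  set I := r * ∫ t, smoothHat t with hI_def
  have hI_le : 3 / 10 * r ≤ I := hI ⟨0, hn⟩ ▸ le_integral_scaledHat (a ⟨0, hn⟩) hr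
  have hI_pos : 0 < I := lt_of_lt_of_le (by positivity) hI_le
  have hNI : ∫ x, N x = n * (2 / r * I ^ (n - 1)) := by
    rw [hN, integral_finsetSum _ fun i _ => ?_]
    · simp_rw [integral_prod_coord]
      rw [Finset.sum_congr rfl (g := fun _ => 2 / r * I ^ (n - 1)) fun i _ => ?_]
      · simp
      rw [← Finset.mul_prod_erase _ _ (Finset.mem_univ i), Function.update_self,
        integral_scaledHatNeg _ hr, Finset.prod_congr rfl (g := fun _ => I) fun j hj => ?_]
      · simp
      rw [Function.update_of_ne (Finset.ne_of_mem_erase hj), hI]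
    · refine integrable_prod_coord fun j => ?_
      rcases eq_or_ne j i with rfl | hj
      · rw [Function.update_self]; exact scaledHatNeg_integrable _ hr
      · rw [Function.update_of_ne hj]; exact scaledHat_integrable _ hr
  have key := (h φ (contDiff_prod fun j _ => (scaledHat_contDiff _ _).comp
      (EuclideanSpace.proj j : EuclideanSpace ℝ (Fin n) →L[ℝ] ℝ).contDiff)
    (hcpt.of_isClosed_subset isClosed_closure hts) (hts.trans hV)
    fun x => Finset.prod_nonneg fun j _ => scaledHat_nonneg _ _ _).trans hint
  rw [hφV, hNI] at key
  simp only [hI, Finset.prod_const, Finset.card_univ, Fintype.card_fin] at key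
  obtain ⟨k, rfl⟩ : ∃ k, n = k + 1 := ⟨n - 1, by omega⟩
  rw [Nat.add_sub_cancel, pow_succ] at key
  have hIk := pow_pos hI_pos k
  have key' : c * I ≤ m * ((k + 1 : ℕ) * (2 / r)) := by
    refine le_of_mul_le_mul_right ?_ hIk
    linarith
  have key'' : c * (3 / 10 * r) ≤ m * ((k + 1 : ℕ) * (2 / r)) :=
    (mul_le_mul_of_nonneg_left hI_le hc).trans key'
  have hkm : 0 < ((k + 1 : ℕ) : ℝ) * m := by positivity
  have := mul_le_mul_of_nonneg_right key'' hr.le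
  rw [show m * (((k + 1 : ℕ) : ℝ) * (2 / r)) * r = 2 * ((k + 1 : ℕ) * m) by field_simp] at this
  nlinarith

lemma IsPreconnected.subset_or_disjoint_of_disjoint_frontier {X : Type*} [TopologicalSpace X]
    {t s : Set X} (ht : IsPreconnected t) (h : Disjoint t (frontier s)) :
    t ⊆ s ∨ Disjoint t s := by
  have hcover : t ⊆ interior s ∪ (closure s)ᶜ := fun x hx => by
    by_contra hx'
    rw [mem_union, not_or, notMem_compl_iff] at hx'
    exact disjoint_left.1 h hx ⟨hx'.2, hx'.1⟩
  have hdisj : Disjoint (interior s) (closure s)ᶜ :=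
    disjoint_compl_right.mono_left interior_subset_closure
  rcases ht.subset_or_subset isOpen_interior isClosed_closure.isOpen_compl hdisj hcover with h' | h'
  · exact Or.inl (h'.trans interior_subset)
  · exact Or.inr ((disjoint_compl_left.mono_right subset_closure).mono_left h')

lemma exists_mem_latticeCube {n : ℕ} {L : ℝ} (hL : 0 < L) (z : EuclideanSpace ℝ (Fin n)) :
    ∃ k, z ∈ latticeCube n L k := by
  refine ⟨fun i => ⌊z i / L⌋, fun i => ⟨?_, ?_⟩⟩
  · rw [mul_comm, ← le_div_iff₀ hL]
    exact Int.floor_le _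
  · have := (div_lt_iff₀ hL).1 (Int.lt_floor_add_one (z i / L))
    linarith

lemma dist_le_of_mem_latticeCube {n : ℕ} {L : ℝ} (hL : 0 ≤ L) {k : Fin n → ℤ}
    {y z : EuclideanSpace ℝ (Fin n)} (hy : y ∈ latticeCube n L k) (hz : z ∈ latticeCube n L k) :
    dist y z ≤ √n * L := by
  rw [EuclideanSpace.dist_eq]
  refine Real.sqrt_le_iff.2 ⟨by positivity, ?_⟩
  rw [mul_pow, Real.sq_sqrt n.cast_nonneg]
  refine (Finset.sum_le_card_nsmul _ _ (L ^ 2) fun i _ => ?_).trans_eq (by simp)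
  refine pow_le_pow_left₀ dist_nonneg ?_ 2
  rw [Real.dist_eq, abs_le]
  constructor <;> linarith [(hy i).1, (hy i).2, (hz i).1, (hz i).2]

lemma mem_latticeCube_of_abs_sub_le {n : ℕ} {L : ℝ} {k : Fin n → ℤ}
    {y : EuclideanSpace ℝ (Fin n)} (hy : ∀ i, |y i - (L * k i + L / 2)| ≤ L / 2) :
    y ∈ latticeCube n L k := fun i => by
  have := abs_le.1 (hy i)
  constructor <;> linarith

/-- **Proposition 4.2:** every point of the bulk free boundary `Γ̃_ε` is within
distance `Cσ` of the free boundary `Γ₀ = ∂{w₀ = 0} ∩ U`, with `C = C(n, λ, c₁)`,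
assuming the sandwich estimate `w₀ - σ² ≤ w_ε ≤ w₀` and the strong non-degeneracy
`w₀ ≥ c₁ dist(·, Γ₀)²` on `{w₀ > 0}`. -/
theorem bulk_fb_close_to_fb (n : ℕ) (lam c₁ : ℝ) (hlam : lam ∈ Set.Ioc (0:ℝ) 1)
    (hc₁ : 0 < c₁) :
    ∃ C > 0, ∀ U : Set (EuclideanSpace ℝ (Fin n)), IsOpen U →
      ∀ σ : ℝ, 0 < σ →
      ∀ Λε : Set (EuclideanSpace ℝ (Fin n)), Λε ⊆ U → closure Λε ∩ U ⊆ Λε →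
      ∀ wε : EuclideanSpace ℝ (Fin n) → ℝ, ContinuousOn wε U →
        (∀ x ∈ U, -σ ^ 2 ≤ wε x) → (∀ x ∈ Λε, wε x ≤ 0) →
        LapGeWeak n (U \ Λε) wε lam →
      ∀ w₀ : EuclideanSpace ℝ (Fin n) → ℝ, ContinuousOn w₀ U →
        (∀ x ∈ U, 0 ≤ w₀ x) →
        (∀ x ∈ U, w₀ x - σ ^ 2 ≤ wε x ∧ wε x ≤ w₀ x) →
        (∀ x ∈ U, 0 < w₀ x →
          c₁ * Metric.infDist x (frontier {y ∈ U | w₀ y = 0} ∩ U) ^ 2 ≤ w₀ x) →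
      ∀ x ∈ frontier (bulkSet n (4 * Real.sqrt (2 * n / lam) * σ) Λε) ∩ U,
        closedBall x (Metric.infDist x (frontier {y ∈ U | w₀ y = 0} ∩ U) +
          Real.sqrt n * (4 * Real.sqrt (2 * n / lam) * σ)) ⊆ U →
        Metric.infDist x (frontier {y ∈ U | w₀ y = 0} ∩ U) ≤ C * σ := by
  obtain ⟨hlam₀, -⟩ := hlam
  refine ⟨√n * (4 * √(2 * n / lam)) + 1 + 1 / √c₁, by positivity, ?_⟩
  intro U hU σ hσ Λ hΛU hΛ w hw hw_ge hw_le hlapw w₀ hw₀ hw₀_nonneg hsand hnd x hx hball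
  rcases n.eq_zero_or_pos with rfl | hn
  · have hx' : frontier (bulkSet 0 (4 * √(2 * (0 : ℕ) / lam) * σ) Λ) = ∅ :=
      isClopen_iff_frontier_eq_empty.1 (isClopen_discrete _)
    rw [hx'] at hx
    exact absurd hx.1 (notMem_empty x)
  set L := 4 * √(2 * n / lam) * σ with hL_def
  set Γ := frontier {y ∈ U | w₀ y = 0} ∩ U with hΓ
  set d := infDist x Γ with hd
  have hL : 0 < L := by positivity
  have hρ : 0 ≤ √n * L := by positivity
  by_contra! hlt
  have hlt' : √n * L + σ + σ / √c₁ < d := by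
    refine lt_of_eq_of_lt ?_ hlt
    rw [hL_def]; ring
  have hσc : 0 < σ / √c₁ := by positivity
  have hballU : ball x d ⊆ U :=
    (ball_subset_closedBall.trans (closedBall_subset_closedBall (by linarith))).trans hball
  have hdisj : Disjoint (ball x d) (frontier {y ∈ U | w₀ y = 0}) :=
    disjoint_left.2 fun y hy hy' => disjoint_left.1 disjoint_ball_infDist hy ⟨hy', hballU hy⟩
  rcases (convex_ball x d).isPreconnected.subset_or_disjoint_of_disjoint_frontier hdisj
    with hzero | hpos
  · rw [frontier_eq_closure_inter_closure] at hx
    obtain ⟨z, hz, hxz⟩ := Metric.mem_closure_iff.1 hx.1.2 σ hσ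
    obtain ⟨k, hk⟩ := exists_mem_latticeCube hL z
    have hkΛ (y) (hy : y ∈ latticeCube n L k) : y ∉ Λ := fun hyΛ =>
      hz (mem_iUnion₂.2 ⟨k, ⟨y, hy, hyΛ⟩, hk⟩)
    have hkball : latticeCube n L k ⊆ ball x d := fun y hy => by
      have h₁ := dist_triangle y z x
      have h₂ := dist_le_of_mem_latticeCube hL.le hy hk
      rw [dist_comm z x] at h₁
      rw [mem_ball]
      linarith
    have := hlapw.mul_sq_lt (r := L / 2) (m := σ ^ 2) (a := fun i => L * k i + L / 2)
      hlam₀.le (by positivity) (by positivity) hn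
      (fun y hy => ⟨hballU (hkball (mem_latticeCube_of_abs_sub_le hy)),
        hkΛ y (mem_latticeCube_of_abs_sub_le hy)⟩)
      (fun y hy => by
        have hy' := hkball (mem_latticeCube_of_abs_sub_le hy)
        have h₀ : w₀ y = 0 := (hzero hy').2
        exact ⟨hw_ge y (hballU hy'), h₀ ▸ (hsand y (hballU hy')).2⟩)
    refine this.ne ?_
    have hsq : √(2 * n / lam) ^ 2 = 2 * n / lam := Real.sq_sqrt (by positivity)
    calc lam * (L / 2) ^ 2 = lam * (4 * √(2 * n / lam) ^ 2 * σ ^ 2) := by rw [hL_def]; ring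
      _ = 8 * n * σ ^ 2 := by rw [hsq]; field_simp; ring
  · obtain ⟨z, hz, hxz⟩ := Metric.mem_closure_iff.1 (frontier_subset_closure hx.1) σ hσ
    obtain ⟨k, ⟨y, hyk, hyΛ⟩, hzk⟩ := mem_iUnion₂.1 hz
    have hxy : dist x y ≤ √n * L + σ := by
      linarith [dist_triangle x z y, dist_le_of_mem_latticeCube hL.le hzk hyk]
    have hyb : y ∈ ball x d := by
      rw [mem_ball, dist_comm]; linarith
    have hyU := hballU hyb
    have hy₀ : 0 < w₀ y := (hw₀_nonneg y hyU).lt_of_ne fun h =>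
      disjoint_left.1 hpos hyb ⟨hyU, h.symm⟩
    have h₁ := hnd y hyU hy₀
    have h₂ : w₀ y ≤ σ ^ 2 := by linarith [(hsand y hyU).1, hw_le y hyΛ]
    have h₃ : σ / √c₁ < infDist y Γ := by
      linarith [infDist_le_infDist_add_dist (s := Γ) (x := x) (y := y)]
    have h₄ : (σ / √c₁) ^ 2 < infDist y Γ ^ 2 := pow_lt_pow_left₀ h₃ hσc.le two_ne_zero
    rw [div_pow, Real.sq_sqrt hc₁.le, div_lt_iff₀ hc₁] at h₄
    linarith
end

section
/- Let U ⊂ ℝⁿ be a bounded open set, λ ∈ (0,1], σ ∈ (0,1], and δ > 0. Let Λ_ε ⊆ U be relatively closed and nonempty with dist(Λ_ε, ∂U) ≥ δ, and let w_ε : U → ℝ be continuous with w_ε ≥ −σ² in U, w_ε ≤ 0 on Λ_ε, and Δw_ε ≥ λ weakly in U ∖ Λ_ε. Let w₀ : U → ℝ be continuous with w₀ ≥ 0, set Λ₀ := {x ∈ U : w₀(x) = 0} and Γ₀ := ∂Λ₀ ∩ U, assume Λ₀ is nonempty with dist(Λ₀, ∂U) ≥ δ, and assume: (sandwich) w₀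 − σ² ≤ w_ε ≤ w₀ in U; (strong non-degeneracy) there is c₁ > 0 with w₀(x) ≥ c₁ dist(x, Γ₀)² whenever w₀(x) > 0; (positive density) there is c₂ ∈ (0,1/2) such that for every x ∈ Λ₀ and r > 0 with B_r(x) ⊆ U there is y ∈ Λ₀ ∩ B_r(x) with cl(B_{c₂ r}(y)) ⊆ Λ₀ ∩ B_r(x). Then there exists C ≥ 1 depending only on n, λ, c₁, c₂, δ and diam(U) such that the Hausdorff distance between the contact sets satisfies d_H(Λ₀, Λ_ε) ≤ C σ. -/
open MeasureTheory Metric Set Bornology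

/-- Chain rule for the composition of `g` with the affine map `z ↦ a • (z - y)`. -/
theorem fderiv_comp_smul_sub_apply {E : Type*} [NormedAddCommGroup E] [NormedSpace ℝ E]
    {g : E → ℝ} (hg : Differentiable ℝ g) (a : ℝ) (y z v : E) :
    fderiv ℝ (fun z => g (a • (z - y))) z v = a * fderiv ℝ g (a • (z - y)) v := by
  have h1 : HasFDerivAt (fun z : E => a • (z - y)) (a • ContinuousLinearMap.id ℝ E) z :=
    ((hasFDerivAt_id z).sub_const y).const_smul a
  have h2 := (hg (a • (z - y))).hasFDerivAt.comp z h1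
  have h3 : HasFDerivAt (fun z => g (a • (z - y))) _ z := h2
  rw [h3.fderiv]
  simp

theorem contDiff_fderiv_apply {E : Type*} [NormedAddCommGroup E] [NormedSpace ℝ E]
    {g : E → ℝ} (hg : ContDiff ℝ (⊤ : ℕ∞) g) (v : E) :
    ContDiff ℝ (⊤ : ℕ∞) (fun y => fderiv ℝ g y v) :=
  (hg.fderiv_right (m := (⊤ : ℕ∞)) (by simp)).clm_apply contDiff_const

theorem lapl_comp_smul_sub (n : ℕ) {g : EuclideanSpace ℝ (Fin n) → ℝ}
    (hg : ContDiff ℝ (⊤ : ℕ∞) g) (a : ℝ) (y z : EuclideanSpace ℝ (Fin n)) :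
    lapl n (fun z => g (a • (z - y))) z = a ^ 2 * lapl n g (a • (z - y)) := by
  unfold lapl
  rw [Finset.mul_sum]
  refine Finset.sum_congr rfl fun i _ => ?_
  set v : EuclideanSpace ℝ (Fin n) := EuclideanSpace.single i 1
  have hgd : Differentiable ℝ g := hg.differentiable (by simp)
  have hgd' : Differentiable ℝ (fun y => fderiv ℝ g y v) :=
    (contDiff_fderiv_apply hg v).differentiable (by simp)
  simp_rw [fderiv_comp_smul_sub_apply hgd]
  rw [fderiv_const_mul, smul_apply,
    fderiv_comp_smul_sub_apply hgd', smul_eq_mul]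
  · ring
  · exact (hgd'.comp ((differentiable_id.sub_const y).const_smul a)) z

theorem continuous_lapl (n : ℕ) {g : EuclideanSpace ℝ (Fin n) → ℝ}
    (hg : ContDiff ℝ (⊤ : ℕ∞) g) : Continuous (lapl n g) :=
  continuous_finsetSum _ fun i _ =>
    (contDiff_fderiv_apply (contDiff_fderiv_apply hg (EuclideanSpace.single i 1))
      (EuclideanSpace.single i 1)).continuous

theorem lapl_eq_zero_of_notMem_tsupport (n : ℕ) {g : EuclideanSpace ℝ (Fin n) → ℝ}
    {x : EuclideanSpace ℝ (Fin n)} (hx : x ∉ tsupport g) : lapl n g x = 0 := by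
  unfold lapl
  refine Finset.sum_eq_zero fun i _ => ?_
  have h0 : g =ᶠ[nhds x] fun _ => 0 := notMem_tsupport_iff_eventuallyEq.mp hx
  have h1 : (fun y => fderiv ℝ g y (EuclideanSpace.single i 1)) =ᶠ[nhds x] fun _ => 0 := by
    filter_upwards [h0.fderiv (𝕜 := ℝ)] with y hy
    simp [hy]
  simp [h1.fderiv_eq]

theorem hasCompactSupport_lapl (n : ℕ) {g : EuclideanSpace ℝ (Fin n) → ℝ}
    (hg : HasCompactSupport g) : HasCompactSupport (lapl n g) :=
  HasCompactSupport.intro hg fun _ hx => lapl_eq_zero_of_notMem_tsupport n hx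

/-- Quadratic growth in weak form: a function of size at most `s` on a ball of radius `R` that
satisfies `Δw ≥ c` weakly there obeys `c R² ≤ K s`, with `K` depending only on the dimension. -/
theorem exists_lapGeWeak_mul_sq_le (n : ℕ) :
    ∃ K : ℝ, 0 ≤ K ∧ ∀ (V : Set (EuclideanSpace ℝ (Fin n)))
      (w : EuclideanSpace ℝ (Fin n) → ℝ) (c s R : ℝ) (y : EuclideanSpace ℝ (Fin n)),
      LapGeWeak n V w c → 0 ≤ s → 0 < R → closedBall y R ⊆ V →
      (∀ x ∈ closedBall y R, |w x| ≤ s) → c * R ^ 2 ≤ K * s := by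
  let ψ : ContDiffBump (0 : EuclideanSpace ℝ (Fin n)) := ⟨1 / 2, 1, by norm_num, by norm_num⟩
  have hψ : ContDiff ℝ (⊤ : ℕ∞) ψ := ψ.contDiff
  have hI : 0 < ∫ x, ψ x := ψ.integral_pos
  have hJ : 0 ≤ ∫ x, |lapl n ψ x| := integral_nonneg fun _ => abs_nonneg _
  refine ⟨(∫ x, |lapl n ψ x|) / ∫ x, ψ x, by positivity, ?_⟩
  intro V w c s R y hw hs hR hV hws
  let φ : EuclideanSpace ℝ (Fin n) → ℝ := fun z => ψ (R⁻¹ • (z - y))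
  have hφ : ContDiff ℝ (⊤ : ℕ∞) φ :=
    hψ.comp ((contDiff_id.sub contDiff_const).const_smul R⁻¹)
  have hsupp : tsupport φ ⊆ closedBall y R := by
    refine closure_minimal (fun z hz => ?_) isClosed_closedBall
    have h1 : R⁻¹ • (z - y) ∈ Function.support ψ := hz
    rw [ψ.support_eq, mem_ball_zero_iff, norm_smul, norm_inv, Real.norm_of_nonneg hR.le] at h1
    rw [mem_closedBall, dist_eq_norm]
    have h2 : R⁻¹ * ‖z - y‖ < 1 := h1
    rw [inv_mul_lt_one₀ hR] at h2
    exact h2.le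
  have hcs : HasCompactSupport φ :=
    (isCompact_closedBall y R).of_isClosed_subset (isClosed_tsupport φ) hsupp
  have key := hw φ hφ hcs (hsupp.trans hV) fun x => ψ.nonneg
  have hint : Integrable (fun x => s * |lapl n φ x|) :=
    ((continuous_lapl n hφ).integrable_of_hasCompactSupport
      (hasCompactSupport_lapl n hcs)).abs.const_mul s
  have h1 : ∫ x in V, w x * lapl n φ x ≤ ∫ x in V, s * |lapl n φ x| := by
    refine (Real.le_norm_self _).trans
      (norm_integral_le_of_norm_le hint.integrableOn (Filter.Eventually.of_forall fun x => ?_))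
    by_cases hx : x ∈ closedBall y R
    · rw [Real.norm_eq_abs, abs_mul]
      exact mul_le_mul_of_nonneg_right (hws x hx) (abs_nonneg _)
    · simp [lapl_eq_zero_of_notMem_tsupport n fun h => hx (hsupp h)]
  have h2 : ∫ x in V, s * |lapl n φ x| ≤ ∫ x, s * |lapl n φ x| :=
    setIntegral_le_integral hint
      (Filter.Eventually.of_forall fun x => mul_nonneg hs (abs_nonneg _))
  have h3 : ∫ x in V, φ x = ∫ x, φ x :=
    setIntegral_eq_integral_of_forall_compl_eq_zero fun x hx =>
      image_eq_zero_of_notMem_tsupport fun h => hx (hV (hsupp h))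
  have scale (f : EuclideanSpace ℝ (Fin n) → ℝ) :
      ∫ z, f (R⁻¹ • (z - y)) = R ^ n * ∫ z, f z := by
    rw [integral_sub_right_eq_self (fun z => f (R⁻¹ • z)) y, Measure.integral_comp_inv_smul,
      finrank_euclideanSpace_fin, abs_of_pos (pow_pos hR n), smul_eq_mul]
  have h4 : ∫ x, φ x = R ^ n * ∫ x, ψ x := scale ψ
  have h5 : ∫ x, s * |lapl n φ x| = s * (R⁻¹ ^ 2 * (R ^ n * ∫ x, |lapl n ψ x|)) := by
    rw [integral_const_mul]
    congr 1
    rw [← scale fun x => |lapl n ψ x|, ← integral_const_mul]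
    refine integral_congr_ae (Filter.Eventually.of_forall fun x => ?_)
    change |lapl n φ x| = _
    rw [lapl_comp_smul_sub n hψ, abs_mul, abs_of_nonneg (sq_nonneg _)]
  rw [h3, h4] at key
  have h6 := key.trans (h1.trans (h2.trans_eq h5))
  rw [div_mul_eq_mul_div, le_div_iff₀ hI]
  have hRn : 0 < R ^ n := pow_pos hR n
  refine le_of_mul_le_mul_left ?_ hRn
  calc R ^ n * (c * R ^ 2 * ∫ x, ψ x) = R ^ 2 * (c * (R ^ n * ∫ x, ψ x)) := by ring
    _ ≤ R ^ 2 * (s * (R⁻¹ ^ 2 * (R ^ n * ∫ x, |lapl n ψ x|))) := by gcongr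
    _ = R ^ n * ((∫ x, |lapl n ψ x|) * s) := by field_simp

theorem ball_subset_of_forall_frontier_le_dist {E : Type*} [NormedAddCommGroup E]
    [NormedSpace ℝ E] {U : Set E} {x : E} {δ : ℝ} (hU : IsOpen U)
    (hx : x ∈ U) (h : ∀ y ∈ frontier U, δ ≤ dist x y) : ball x δ ⊆ U := by
  rcases le_or_gt δ 0 with hδ | hδ
  · simp [ball_eq_empty.mpr hδ]
  refine (convex_ball x δ).isPreconnected.subset_left_of_subset_union hU
    isClosed_closure.isOpen_compl (disjoint_compl_right.mono_left subset_closure)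
    (fun z hz => ?_) ⟨x, mem_ball_self hδ, hx⟩
  by_contra hzU
  rw [mem_union, mem_compl_iff, not_or, not_not] at hzU
  have hzf : z ∈ frontier U := hU.frontier_eq ▸ ⟨hzU.2, hzU.1⟩
  exact absurd (h z hzf) (not_le.mpr (by rwa [mem_ball'] at hz))

/-- **Remark 1.4:** Hausdorff distance estimate between the contact sets themselves:
`d_H(Λ₀, Λ_ε) ≤ Cσ` with `C` depending only on `n, λ, c₁, c₂, δ` and `diam U`,
assuming the sandwich estimate `w₀ - σ² ≤ w_ε ≤ w₀`, the strong non-degeneracy of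
`w₀`, and the positive density of `Λ₀ = {w₀ = 0}`. -/
theorem contact_set_hausdorff_estimate (n : ℕ) (lam c₁ c₂ δ D : ℝ)
    (hlam : lam ∈ Set.Ioc (0:ℝ) 1) (hc₁ : 0 < c₁)
    (hc₂ : c₂ ∈ Set.Ioo (0:ℝ) (1/2)) (hδ : 0 < δ) (hD : 0 < D) :
    ∃ C ≥ 1, ∀ U : Set (EuclideanSpace ℝ (Fin n)), IsOpen U → IsBounded U →
      Metric.diam U ≤ D →
      ∀ σ ∈ Set.Ioc (0:ℝ) 1,
      ∀ Λε : Set (EuclideanSpace ℝ (Fin n)), Λε ⊆ U → closure Λε ∩ U ⊆ Λε →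
        Λε.Nonempty → (∀ x ∈ Λε, ∀ y ∈ frontier U, δ ≤ dist x y) →
      ∀ wε : EuclideanSpace ℝ (Fin n) → ℝ, ContinuousOn wε U →
        (∀ x ∈ U, -σ ^ 2 ≤ wε x) → (∀ x ∈ Λε, wε x ≤ 0) →
        LapGeWeak n (U \ Λε) wε lam →
      ∀ w₀ : EuclideanSpace ℝ (Fin n) → ℝ, ContinuousOn w₀ U →
        (∀ x ∈ U, 0 ≤ w₀ x) →
        {y ∈ U | w₀ y = 0}.Nonempty →
        (∀ x ∈ {y ∈ U | w₀ y = 0}, ∀ y ∈ frontier U, δ ≤ dist x y) →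
        (∀ x ∈ U, w₀ x - σ ^ 2 ≤ wε x ∧ wε x ≤ w₀ x) →
        (∀ x ∈ U, 0 < w₀ x →
          c₁ * Metric.infDist x (frontier {y ∈ U | w₀ y = 0} ∩ U) ^ 2 ≤ w₀ x) →
        (∀ x ∈ {y ∈ U | w₀ y = 0}, ∀ r : ℝ, 0 < r → ball x r ⊆ U →
          ∃ y ∈ {y ∈ U | w₀ y = 0} ∩ ball x r,
            closedBall y (c₂ * r) ⊆ {y ∈ U | w₀ y = 0} ∩ ball x r) →
        Metric.hausdorffDist {y ∈ U | w₀ y = 0} Λε ≤ C * σ := by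
  obtain ⟨K, hK, hKw⟩ := exists_lapGeWeak_mul_sq_le n
  have hl : 0 < lam := hlam.1
  have hc2 : 0 < c₂ := hc₂.1
  set M : ℝ := √(K / lam) + 1 with hM
  have hMpos : 0 < M := by positivity
  have hMK : K < lam * M ^ 2 := by
    have h1 : √(K / lam) ^ 2 = K / lam := Real.sq_sqrt (by positivity)
    have h2 : K / lam < M ^ 2 := by
      rw [← h1]
      have := Real.sqrt_nonneg (K / lam)
      rw [hM]
      nlinarith
    rw [div_lt_iff₀ hl] at h2
    linarith
  have hs1 : 0 < √c₁ := Real.sqrt_pos.mpr hc₁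
  refine ⟨1 + 1 / √c₁ + M / c₂ + D * (M / c₂) / δ, ?_, ?_⟩
  · have : 0 ≤ 1 / √c₁ + M / c₂ + D * (M / c₂) / δ := by positivity
    linarith
  intro U hU hUb hdiam σ hσ Λε hΛU hΛcl hΛne hΛδ wε hwc hwlow hwΛ hwlap w₀ hw₀c hw₀
    hne hδ₀ hsand hnd hdens
  have hσ0 : 0 < σ := hσ.1
  set Λ₀ : Set (EuclideanSpace ℝ (Fin n)) := {y ∈ U | w₀ y = 0} with hΛ₀
  have hA : 0 ≤ 1 / √c₁ := by positivity
  have hB : 0 ≤ M / c₂ := by positivity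
  have hE : 0 ≤ D * (M / c₂) / δ := by positivity
  refine hausdorffDist_le_of_mem_dist (by positivity) ?_ ?_
  · intro x hx
    rcases le_or_gt (M / c₂ * σ) δ with hr | hr
    · have hrpos : 0 < M / c₂ * σ := by positivity
      have hball : ball x (M / c₂ * σ) ⊆ U :=
        (ball_subset_ball hr).trans (ball_subset_of_forall_frontier_le_dist hU hx.1 (hδ₀ x hx))
      obtain ⟨y, -, hy⟩ := hdens x hx _ hrpos hball
      have hR : c₂ * (M / c₂ * σ) = M * σ := by field_simp
      rw [hR] at hy
      have hmeet : ∃ z ∈ closedBall y (M * σ), z ∈ Λε := by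
        by_contra! hcon
        have h1 := hKw (U \ Λε) wε lam (σ ^ 2) (M * σ) y hwlap (sq_nonneg σ) (by positivity)
          (fun z hz => ⟨(hy hz).1.1, hcon z hz⟩) (fun z hz => by
            have hz0 := (hy hz).1
            have h2 := (hsand z hz0.1).2
            rw [hz0.2] at h2
            rw [abs_le]
            constructor
            · simpa using hwlow z hz0.1
            · nlinarith [sq_nonneg σ])
        have h3 : K * σ ^ 2 < lam * M ^ 2 * σ ^ 2 := by gcongr
        nlinarith
      obtain ⟨z, hz, hzΛ⟩ := hmeet
      refine ⟨z, hzΛ, ?_⟩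
      have h4 : dist x z < M / c₂ * σ := by
        have := (hy hz).2
        rwa [mem_ball'] at this
      refine h4.le.trans (mul_le_mul_of_nonneg_right ?_ hσ0.le)
      linarith
    · obtain ⟨z, hz⟩ := hΛne
      refine ⟨z, hz, ?_⟩
      have h1 : dist x z ≤ D := (dist_le_diam_of_mem hUb hx.1 (hΛU hz)).trans hdiam
      have h2 : D ≤ D * (M / c₂) / δ * σ := by
        rw [div_mul_eq_mul_div, le_div_iff₀ hδ, mul_assoc]
        exact mul_le_mul_of_nonneg_left hr.le hD.le
      refine (h1.trans h2).trans (mul_le_mul_of_nonneg_right ?_ hσ0.le)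
      linarith
  · intro x hx
    have hxU := hΛU hx
    rcases (hw₀ x hxU).eq_or_lt with h0 | hpos
    · exact ⟨x, ⟨hxU, h0.symm⟩, by rw [dist_self]; positivity⟩
    have hcl : closure Λ₀ ⊆ U := by
      intro z hz
      by_contra hzU
      have hzf : z ∈ frontier U := by
        rw [hU.frontier_eq]
        exact ⟨closure_mono (fun _ h => h.1) hz, hzU⟩
      obtain ⟨y, hy, hyz⟩ := Metric.mem_closure_iff.mp hz δ hδ
      exact absurd (hδ₀ y hy z hzf) (not_le.mpr (by rwa [dist_comm]))
    have hfne : (frontier Λ₀ ∩ U).Nonempty := by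
      obtain ⟨z, hz⟩ := nonempty_frontier_iff.mpr
        ⟨hne, fun h => hpos.ne' (h.symm ▸ mem_univ x : x ∈ Λ₀).2⟩
      exact ⟨z, hz, hcl (frontier_subset_closure hz)⟩
    have hclosed : closure Λ₀ ⊆ Λ₀ := by
      intro z hz
      refine ⟨hcl hz, ?_⟩
      have h1 : ContinuousWithinAt w₀ Λ₀ z :=
        (hw₀c z (hcl hz)).mono fun _ h => h.1
      have h2 := h1.mem_closure_image hz
      have h3 : w₀ '' Λ₀ ⊆ {0} := by
        rintro _ ⟨y, hy, rfl⟩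
        exact hy.2
      simpa using closure_mono h3 h2
    have hdist : infDist x (frontier Λ₀ ∩ U) < (1 / √c₁ + 1) * σ := by
      have h1 := hnd x hxU hpos
      have h2 : w₀ x ≤ σ ^ 2 := by linarith [(hsand x hxU).1, hwΛ x hx]
      have h3 : √c₁ * infDist x (frontier Λ₀ ∩ U) ≤ σ := by
        refine le_of_sq_le_sq ?_ hσ0.le
        rw [mul_pow, Real.sq_sqrt hc₁.le]
        exact h1.trans h2
      have h4 : infDist x (frontier Λ₀ ∩ U) ≤ 1 / √c₁ * σ := by
        rw [div_mul_eq_mul_div, one_mul, le_div_iff₀ hs1]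
        linarith
      linarith
    obtain ⟨z, hz, hxz⟩ := (infDist_lt_iff hfne).mp hdist
    refine ⟨z, hclosed (frontier_subset_closure hz.1), hxz.le.trans ?_⟩
    exact mul_le_mul_of_nonneg_right (by linarith) hσ0.le
end

section
/- Let n ≥ 1, ρ > 0, A > 0 and x₀ ∈ ℝⁿ. Let w : B_{2ρ}(x₀) → ℝ be continuously differentiable with Lipschitz continuous gradient (so that Δw exists almost everywhere). Assume |w(y)| ≤ A ρ² for all y ∈ B_{2ρ}(x₀) and −w(y) Δw(y) ≤ A ρ² for almost every y ∈ B_{2ρ}(x₀). Then there exists a constant C > 0 depending only on n and A such that the averaged gradient bound (⨍_{B_ρ(x₀)} |∇w(y)|² dy)^{1/2} ≤ C ρ holds, where ⨍ denotes the average integral. -/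
open MeasureTheory Metric Set

/-- Smooth cutoffs between concentric balls of radii `ρ` and `2 * ρ`, with gradient of size
`K / ρ`. -/
lemma exists_cutoff_norm_fderiv_le (E : Type*) [NormedAddCommGroup E] [NormedSpace ℝ E]
    [FiniteDimensional ℝ E] :
    ∃ K : ℝ, ∀ ρ : ℝ, 0 < ρ → ∀ x₀ : E, ∃ η : E → ℝ, ContDiff ℝ 1 η ∧
      (∀ x, ‖fderiv ℝ η x‖ ≤ K / ρ) ∧ (∀ x, 0 ≤ η x) ∧ (∀ x, η x ≤ 1) ∧
      (∀ x ∈ ball x₀ ρ, η x = 1) ∧ HasCompactSupport η ∧ tsupport η ⊆ ball x₀ (2 * ρ) := by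
  let φ : ContDiffBump (0 : E) := ⟨1, 3 / 2, by norm_num, by norm_num⟩
  obtain ⟨K, hK⟩ := (φ.hasCompactSupport.fderiv ℝ).exists_bound_of_continuous
    ((φ.contDiff (n := 1)).continuous_fderiv one_ne_zero)
  refine ⟨K, fun ρ hρ x₀ => ⟨fun x => φ (ρ⁻¹ • (x - x₀)), ?_, ?_, fun x => φ.nonneg,
    fun x => φ.le_one, ?_, ?_⟩⟩
  · exact φ.contDiff.comp (by fun_prop)
  · intro x
    have hd : HasFDerivAt (fun x => φ (ρ⁻¹ • (x - x₀)))
        ((fderiv ℝ φ (ρ⁻¹ • (x - x₀))).comp (ρ⁻¹ • ContinuousLinearMap.id ℝ E)) x :=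
      (((φ.contDiff (n := 1)).differentiable one_ne_zero _).hasFDerivAt).comp x
        (((hasFDerivAt_id x).sub_const x₀).const_smul ρ⁻¹)
    rw [hd.fderiv, ContinuousLinearMap.comp_smul, ContinuousLinearMap.comp_id, norm_smul,
      Real.norm_of_nonneg (by positivity), div_eq_inv_mul]
    gcongr
    exact hK _
  · intro x hx
    refine φ.one_of_mem_closedBall ?_
    rw [mem_ball, dist_eq_norm] at hx
    rw [mem_closedBall_zero_iff, norm_smul, Real.norm_of_nonneg (by positivity),
      inv_mul_le_iff₀ hρ]
    simpa [φ] using hx.le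
  · have hsub : tsupport (fun x => φ (ρ⁻¹ • (x - x₀))) ⊆ closedBall x₀ (3 / 2 * ρ) := by
      refine closure_minimal (fun x hx => ?_) isClosed_closedBall
      by_contra hne
      refine hx (φ.zero_of_le_dist ?_)
      rw [mem_closedBall, dist_eq_norm, not_le] at hne
      rw [dist_zero_right, norm_smul, Real.norm_of_nonneg (by positivity), le_inv_mul_iff₀ hρ]
      simp only [φ]
      linarith
    have : ProperSpace E := FiniteDimensional.proper_real E
    exact ⟨(isCompact_closedBall _ _).of_isClosed_subset (isClosed_tsupport _) hsub,
      hsub.trans (closedBall_subset_ball (by linarith))⟩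

lemma EuclideanSpace.sum_sq_apply_single {n : ℕ} (p : EuclideanSpace ℝ (Fin n) →L[ℝ] ℝ) :
    ∑ i, p (EuclideanSpace.single i 1) ^ 2 = ‖p‖ ^ 2 := by
  have h := (EuclideanSpace.basisFun (Fin n) ℝ).sum_sq_norm_inner_left
    ((InnerProductSpace.toDual ℝ _).symm p)
  simpa [InnerProductSpace.toDual_symm_apply] using h

lemma EuclideanSpace.volume_real_ball_two_mul {n : ℕ} (x : EuclideanSpace ℝ (Fin n)) {r : ℝ} :
    volume.real (ball x (2 * r)) = 2 ^ n * volume.real (ball x r) := by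
  rw [Measure.addHaar_real_ball_center _ x r, measureReal_def, measureReal_def,
    Measure.addHaar_ball_mul_of_pos _ _ two_pos]
  simp

/-- Multiplying by a cutoff supported in `s` preserves global smoothness. -/
lemma ContDiffOn.mul_of_tsupport_subset {E : Type*} [NormedAddCommGroup E] [NormedSpace ℝ E]
    {k : WithTop ℕ∞} {f η : E → ℝ} {s : Set E} (hf : ContDiffOn ℝ k f s) (hs : IsOpen s)
    (hη : ContDiff ℝ k η) (hsupp : tsupport η ⊆ s) : ContDiff ℝ k (fun x => f x * η x) := by
  rw [contDiff_iff_contDiffAt]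
  intro x
  by_cases hx : x ∈ tsupport η
  · exact (hf.contDiffAt (hs.mem_nhds (hsupp hx))).mul hη.contDiffAt
  · refine (contDiffAt_const (c := (0 : ℝ))).congr_of_eventuallyEq ?_
    filter_upwards [notMem_tsupport_iff_eventuallyEq.1 hx] with y hy
    simp [hy]

lemma ae_lineDeriv_eq_of_eqOn {n : ℕ} {f G : EuclideanSpace ℝ (Fin n) → ℝ}
    {s : Set (EuclideanSpace ℝ (Fin n))} {L : NNReal} (hG : LipschitzWith L G) (hs : IsOpen s)
    (hfG : EqOn f G s) (v : EuclideanSpace ℝ (Fin n)) :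
    ∀ᵐ x, x ∈ s → lineDeriv ℝ G x v = fderiv ℝ f x v := by
  filter_upwards [hG.ae_differentiableAt (μ := volume)] with x hx hxs
  rw [hx.lineDeriv_eq_fderiv, (hfG.eventuallyEq_of_mem (hs.mem_nhds hxs)).fderiv_eq]

/-- Testing `-w Δw` against the square of a cutoff function. -/
lemma setIntegral_norm_fderiv_sq_le {n : ℕ} {ρ M B κ : ℝ} {L : NNReal}
    {x₀ : EuclideanSpace ℝ (Fin n)} {w η : EuclideanSpace ℝ (Fin n) → ℝ} (hρ : 0 < ρ)
    (hB : 0 ≤ B) (hw : ContDiffOn ℝ 1 w (ball x₀ (2 * ρ)))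
    (hL : LipschitzOnWith L (fun y => fderiv ℝ w y) (ball x₀ (2 * ρ)))
    (hM : ∀ y ∈ ball x₀ (2 * ρ), |w y| ≤ M)
    (hΔ : ∀ᵐ y, y ∈ ball x₀ (2 * ρ) → -(w y) * lapl n w y ≤ B)
    (hη : ContDiff ℝ 1 η) (hκ : ∀ x, ‖fderiv ℝ η x‖ ≤ κ) (hη0 : ∀ x, 0 ≤ η x)
    (hη1 : ∀ x, η x ≤ 1) (hone : ∀ x ∈ ball x₀ ρ, η x = 1) (hcs : HasCompactSupport η)
    (hsupp : tsupport η ⊆ ball x₀ (2 * ρ)) :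
    ∫ y in ball x₀ ρ, ‖fderiv ℝ w y‖ ^ 2
      ≤ (2 * B + 4 * M ^ 2 * κ ^ 2) * volume.real (ball x₀ (2 * ρ)) := by
  set U := ball x₀ (2 * ρ)
  have hUo : IsOpen U := isOpen_ball
  let e : Fin n → EuclideanSpace ℝ (Fin n) := fun i => EuclideanSpace.single i 1
  have hext : ∀ i, ∃ C : NNReal, ∃ G : EuclideanSpace ℝ (Fin n) → ℝ, LipschitzWith C G ∧
      EqOn (fun y => fderiv ℝ w y (e i)) G U := by
    intro i
    obtain ⟨G, hG, hGeq⟩ := LipschitzOnWith.extend_real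
      (((ContinuousLinearMap.apply ℝ ℝ (e i)).lipschitz).comp_lipschitzOnWith hL)
    exact ⟨_, G, hG, hGeq⟩
  choose C G hG hGeq using hext
  have hη2supp : tsupport (fun x => η x ^ 2) ⊆ tsupport η :=
    closure_mono fun x hx => by
      simp only [Function.mem_support] at hx ⊢
      exact fun h => hx (by simp [h])
  let g : EuclideanSpace ℝ (Fin n) → ℝ := fun x => w x * η x ^ 2
  have hg : ContDiff ℝ 1 g :=
    hw.mul_of_tsupport_subset hUo (hη.pow 2) (hη2supp.trans hsupp)
  have hη2cs : HasCompactSupport (fun x => η x ^ 2) :=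
    hcs.of_isClosed_subset (isClosed_tsupport _) hη2supp
  have hgcs : HasCompactSupport g := hη2cs.mul_left
  obtain ⟨D, hgL⟩ := hg.lipschitzWith_of_hasCompactSupport hgcs one_ne_zero
  have hint1 : ∀ i, Integrable (fun x => lineDeriv ℝ (G i) x (e i) * g x) := fun i =>
    ((hG i).locallyIntegrable_lineDeriv (e i)).integrable_smul_right_of_hasCompactSupport
      hg.continuous hgcs
  have hint2 : ∀ i, Integrable (fun x => fderiv ℝ g x (e i) * G i x) := fun i =>
    (((hg.continuous_fderiv one_ne_zero).clm_apply continuous_const).mul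
      (hG i).continuous).integrable_of_hasCompactSupport
        ((hgcs.fderiv_apply ℝ (e i)).mul_right)
  have hparts : ∫ x, ∑ i, fderiv ℝ g x (e i) * G i x
      = -∫ x, ∑ i, lineDeriv ℝ (G i) x (e i) * g x := by
    rw [integral_finsetSum _ fun i _ => hint1 i, integral_finsetSum _ fun i _ => hint2 i,
      ← Finset.sum_neg_distrib]
    refine Finset.sum_congr rfl fun i _ => ?_
    rw [(hG i).integral_lineDeriv_mul_eq hgL hgcs, ← integral_neg]
    congr 1 with x
    rw [(hg.differentiable one_ne_zero x).lineDeriv_eq_fderiv]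
    simp
  have hzero : ∀ x, x ∉ U → η x = 0 := fun x hx =>
    image_eq_zero_of_notMem_tsupport fun h => hx (hsupp h)
  have hupper : -∫ x, ∑ i, lineDeriv ℝ (G i) x (e i) * g x ≤ B * volume.real U := by
    rw [← integral_neg]
    calc _ ≤ ∫ x, U.indicator (fun _ => B) x := by
          refine integral_mono_ae (integrable_finsetSum _ fun i _ => hint1 i).neg
            ((integrable_indicator_iff measurableSet_ball).2
              (integrableOn_const measure_ball_lt_top.ne)) ?_
          filter_upwards [hΔ, ae_all_iff.2 fun i =>
            ae_lineDeriv_eq_of_eqOn (hG i) hUo (hGeq i) (e i)] with x hx hxi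
          by_cases hxU : x ∈ U
          · rw [indicator_of_mem hxU, ← Finset.sum_mul]
            have hl : ∑ i, lineDeriv ℝ (G i) x (e i) = lapl n w x :=
              Finset.sum_congr rfl fun i _ => hxi i hxU
            rw [hl]
            have h1 : η x ^ 2 ≤ 1 := pow_le_one₀ (hη0 x) (hη1 x)
            calc -(lapl n w x * (w x * η x ^ 2)) = (-(w x) * lapl n w x) * η x ^ 2 := by ring
              _ ≤ B * η x ^ 2 := by gcongr; exact hx hxU
              _ ≤ B := mul_le_of_le_one_right hB h1
          · simp [indicator_of_notMem hxU, g, hzero x hxU]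
      _ = B * volume.real U := by
          rw [integral_indicator measurableSet_ball, setIntegral_const, smul_eq_mul, mul_comm]
  have hinB : IntegrableOn (fun y => ‖fderiv ℝ w y‖ ^ 2) (ball x₀ ρ) := by
    refine IntegrableOn.mono_set ?_ (ball_subset_closedBall : ball x₀ ρ ⊆ closedBall x₀ ρ)
    exact ((hL.continuousOn.mono (closedBall_subset_ball (by linarith))).norm.pow
      2).integrableOn_compact (isCompact_closedBall _ _)
  have hinU : IntegrableOn (fun _ => 2 * M ^ 2 * κ ^ 2) U :=
    integrableOn_const measure_ball_lt_top.ne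
  have hlower : (1 / 2) * ∫ y in ball x₀ ρ, ‖fderiv ℝ w y‖ ^ 2
      ≤ (∫ x, ∑ i, fderiv ℝ g x (e i) * G i x) + 2 * M ^ 2 * κ ^ 2 * volume.real U := by
    have hconst : ∫ x, U.indicator (fun _ => 2 * M ^ 2 * κ ^ 2) x
        = 2 * M ^ 2 * κ ^ 2 * volume.real U := by
      rw [integral_indicator measurableSet_ball, setIntegral_const, smul_eq_mul, mul_comm]
    rw [← hconst, ← integral_indicator measurableSet_ball, ← integral_const_mul,
      ← integral_add (integrable_finsetSum _ fun i _ => hint2 i)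
        ((integrable_indicator_iff measurableSet_ball).2 hinU)]
    refine integral_mono
      (((integrable_indicator_iff measurableSet_ball).2 hinB).const_mul _)
      ((integrable_finsetSum _ fun i _ => hint2 i).add
        ((integrable_indicator_iff measurableSet_ball).2 hinU)) fun x => ?_
    by_cases hxU : x ∈ U
    · have hwd := (hw.contDiffAt (hUo.mem_nhds hxU)).differentiableAt one_ne_zero
      have hgd : fderiv ℝ g x
          = w x • (2 * η x) • fderiv ℝ η x + η x ^ 2 • fderiv ℝ w x := by
        have h := hwd.hasFDerivAt.mul
          (((hη.differentiable one_ne_zero x).hasFDerivAt).pow 2)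
        simpa using! h.fderiv
      have hyoung : (1 / 2) * (η x ^ 2 * ‖fderiv ℝ w x‖ ^ 2)
          ≤ (∑ i, fderiv ℝ g x (e i) * G i x) + 2 * w x ^ 2 * ‖fderiv ℝ η x‖ ^ 2 := by
        rw [← EuclideanSpace.sum_sq_apply_single, ← EuclideanSpace.sum_sq_apply_single,
          Finset.mul_sum, Finset.mul_sum, Finset.mul_sum, ← Finset.sum_add_distrib]
        refine Finset.sum_le_sum fun i _ => ?_
        rw [← hGeq i hxU, hgd]
        simp only [add_apply, smul_apply, smul_eq_mul,
          e]
        nlinarith [sq_nonneg (η x * fderiv ℝ w x (EuclideanSpace.single i 1)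
          + 2 * w x * fderiv ℝ η x (EuclideanSpace.single i 1))]
      have hind : (ball x₀ ρ).indicator (fun y => ‖fderiv ℝ w y‖ ^ 2) x
          ≤ η x ^ 2 * ‖fderiv ℝ w x‖ ^ 2 := by
        by_cases hx : x ∈ ball x₀ ρ
        · simp [indicator_of_mem hx, hone x hx]
        · rw [indicator_of_notMem hx]
          positivity
      have hwM : w x ^ 2 ≤ M ^ 2 := by
        rw [← sq_abs]
        gcongr
        exact hM x hxU
      have hprod : 2 * w x ^ 2 * ‖fderiv ℝ η x‖ ^ 2 ≤ 2 * M ^ 2 * κ ^ 2 := by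
        gcongr
        exact hκ x
      rw [indicator_of_mem hxU]
      linarith
    · have hxB : x ∉ ball x₀ ρ := fun h => hxU (ball_subset_ball (by linarith) h)
      have hgx : fderiv ℝ g x = 0 := by
        refine image_eq_zero_of_notMem_tsupport fun h => hxU ?_
        exact hsupp (hη2supp (tsupport_mul_subset_right (tsupport_fderiv_subset ℝ h)))
      rw [indicator_of_notMem hxU, indicator_of_notMem hxB]
      simp [hgx]
  linarith

/-- **Caccioppoli-type estimate.**  There is `C = C(n, A) > 0` such that any `C¹`
function `w` with Lipschitz gradient on `B_{2ρ}(x₀)` satisfying `|w| ≤ Aρ²` on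
`B_{2ρ}(x₀)` and `-w Δw ≤ Aρ²` a.e. on `B_{2ρ}(x₀)` obeys
`(⨍_{B_ρ(x₀)} |∇w|²)^{1/2} ≤ Cρ`. -/
theorem caccioppoli_estimate (n : ℕ) (hn : 1 ≤ n) (A : ℝ) (hA : 0 < A) :
    ∃ C > 0, ∀ ρ : ℝ, 0 < ρ → ∀ x₀ : EuclideanSpace ℝ (Fin n),
      ∀ w : EuclideanSpace ℝ (Fin n) → ℝ, ∀ L : NNReal,
        ContDiffOn ℝ 1 w (ball x₀ (2 * ρ)) →
        LipschitzOnWith L (fun y => fderiv ℝ w y) (ball x₀ (2 * ρ)) →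
        (∀ y ∈ ball x₀ (2 * ρ), |w y| ≤ A * ρ ^ 2) →
        (∀ᵐ y : EuclideanSpace ℝ (Fin n),
          y ∈ ball x₀ (2 * ρ) → -(w y) * lapl n w y ≤ A * ρ ^ 2) →
        Real.sqrt (⨍ y in ball x₀ ρ, ‖gradient w y‖ ^ 2) ≤ C * ρ := by
  obtain ⟨K, hK⟩ := exists_cutoff_norm_fderiv_le (EuclideanSpace ℝ (Fin n))
  refine ⟨Real.sqrt (2 ^ n * (2 * A + 4 * A ^ 2 * K ^ 2)), by positivity, ?_⟩
  intro ρ hρ x₀ w L hw hL hM hΔ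
  obtain ⟨η, hη, hκ, hη0, hη1, hone, hcs, hsupp⟩ := hK ρ hρ x₀
  have hmain := setIntegral_norm_fderiv_sq_le hρ (by positivity) hw hL hM hΔ hη hκ hη0 hη1 hone
    hcs hsupp
  have hgrad : ∀ y, ‖gradient w y‖ = ‖fderiv ℝ w y‖ := fun y => by simp [gradient]
  have hvol : 0 < volume.real (ball x₀ ρ) :=
    ENNReal.toReal_pos (measure_ball_pos _ _ hρ).ne' measure_ball_lt_top.ne
  refine Real.sqrt_le_iff.2 ⟨by positivity, ?_⟩
  rw [mul_pow, Real.sq_sqrt (by positivity), setAverage_eq, smul_eq_mul,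
    inv_mul_le_iff₀ hvol]
  simp only [hgrad]
  refine hmain.trans_eq ?_
  rw [EuclideanSpace.volume_real_ball_two_mul]
  field_simp
end

section
/- Let U ⊆ ℝⁿ be open, λ ∈ (0,1], σ ∈ (0,1], M ≥ 1 and K ≥ 1. Let Λ₀, Λ_ε ⊆ U be relatively closed in U, and let w₀, w_ε : U → ℝ be continuously differentiable with Lipschitz continuous gradients on U (so their Laplacians exist almost everywhere). Assume: (a) w₀ − σ² ≤ w_ε ≤ w₀ in U; (b) w_ε − w₀ is harmonic in the open set U ∖ (Λ₀ ∪ Λ_ε); (c) w₀ ≥ 0 in U, w₀ = 0 and ∇w₀ = 0 on Λ₀, 0 ≤ w₀(y) ≤ M·dist(y, Λ₀)² and |∇w₀(y)| ≤ M·dist(y, Λ₀) for all y ∈ U; (d) every point of Λ₀ ∪ Λ_ε lies within distance K σ of Λ₀; (e) w_ε ≥ −σ² in U, Δw_ε ≤ λ⁻¹ almost everywhere in U, and Δw_ε ≥ 0 almost everywhere on {w_ε > 0}. Then there exists C > 0 depending only on n, λ, M and K such that for every x ∈ U with cl(B_{3σ}(x)) ⊆ U, the averaged gradient estimate (⨍_{B_σ(x)}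 |∇w₀(y) − ∇w_ε(y)|² dy)^{1/2} ≤ C σ holds, where ⨍ denotes the average integral. -/
open MeasureTheory Metric Set

/-- In `ℝⁿ` there are cutoff functions equal to `1` on `B_σ(x)`, supported in the closed ball
of radius `2σ`, whose gradient is bounded by `G / σ` with `G` depending only on `n`. -/
theorem exists_cutoff (n : ℕ) :
    ∃ G : ℝ, 0 ≤ G ∧ ∀ (x : EuclideanSpace ℝ (Fin n)) (σ : ℝ), 0 < σ →
      ∃ η : EuclideanSpace ℝ (Fin n) → ℝ, ContDiff ℝ 1 η ∧ tsupport η ⊆ closedBall x (2 * σ) ∧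
        (∀ y ∈ ball x σ, η y = 1) ∧ (∀ y, η y ∈ Icc (0 : ℝ) 1) ∧
        ∀ y v, |fderiv ℝ η y v| ≤ G / σ * ‖v‖ := by
  let b : ContDiffBump (0 : EuclideanSpace ℝ (Fin n)) := ⟨1, 2, one_pos, one_lt_two⟩
  obtain ⟨G, hG⟩ := ContDiff.lipschitzWith_of_hasCompactSupport (𝕂 := ℝ) (n := 1)
    b.hasCompactSupport b.contDiff one_ne_zero
  refine ⟨G, G.2, fun x σ hσ => ?_⟩
  have hnorm : ∀ y, ‖σ⁻¹ • (y - x)‖ = σ⁻¹ * dist y x := fun y => by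
    rw [norm_smul, Real.norm_of_nonneg (inv_pos.2 hσ).le, dist_eq_norm]
  refine ⟨fun y => b (σ⁻¹ • (y - x)), ?_, ?_, ?_, fun y => ⟨b.nonneg, b.le_one⟩, ?_⟩
  · exact b.contDiff.comp (by fun_prop)
  · refine closure_minimal (fun y hy => ?_) isClosed_closedBall
    rw [mem_closedBall]
    by_contra! h
    refine hy (b.zero_of_le_dist ?_)
    rw [dist_zero_right, hnorm]
    change 2 ≤ _
    rw [inv_mul_eq_div, le_div_iff₀ hσ]
    exact h.le
  · intro y hy
    refine b.one_of_mem_closedBall ?_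
    rw [mem_closedBall, dist_zero_right, hnorm]
    change _ ≤ 1
    rw [inv_mul_eq_div, div_le_one hσ]
    exact (mem_ball.1 hy).le
  · intro y v
    have hlip : LipschitzWith (G * ⟨σ⁻¹, (inv_pos.2 hσ).le⟩) (fun y => b (σ⁻¹ • (y - x))) := by
      refine hG.comp (LipschitzWith.of_dist_le_mul fun y z => ?_)
      rw [dist_smul₀, dist_sub_right, Real.norm_of_nonneg (inv_pos.2 hσ).le]
      rfl
    have h := (fderiv ℝ (fun y => b (σ⁻¹ • (y - x))) y).le_of_opNorm_le
      (norm_fderiv_le_of_lipschitz ℝ hlip) v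
    rwa [Real.norm_eq_abs] at h

/-- The squared norm of the gradient is the sum of the squares of the partial derivatives. -/
theorem norm_gradient_sq (n : ℕ) (u : EuclideanSpace ℝ (Fin n) → ℝ)
    (y : EuclideanSpace ℝ (Fin n)) :
    ‖gradient u y‖ ^ 2 = ∑ i : Fin n, fderiv ℝ u y (EuclideanSpace.single i 1) ^ 2 := by
  rw [EuclideanSpace.real_norm_sq_eq]
  refine Finset.sum_congr rfl fun i _ => ?_
  have h : inner ℝ (gradient u y) (EuclideanSpace.single i 1) =
      fderiv ℝ u y (EuclideanSpace.single i 1) := InnerProductSpace.toDual_symm_apply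
  rw [← h, EuclideanSpace.inner_single_right]
  simp

/-- Integration by parts `∫ ∇g · ∇u = -∫ g Δu` for a `C¹` function `g` compactly supported in an
open set on which `u` has Lipschitz gradient, together with the integrability of both sides. -/
theorem integral_mul_lapl (n : ℕ) {s : Set (EuclideanSpace ℝ (Fin n))} (hs : IsOpen s)
    {u g : EuclideanSpace ℝ (Fin n) → ℝ} {L : NNReal}
    (hu : LipschitzOnWith L (fun y => fderiv ℝ u y) s)
    (hg : ContDiff ℝ 1 g) (hgc : HasCompactSupport g) (hgs : tsupport g ⊆ s) :
    Integrable (fun y => g y * lapl n u y) ∧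
    Integrable (fun y => ∑ i : Fin n, fderiv ℝ g y (EuclideanSpace.single i 1) *
        fderiv ℝ u y (EuclideanSpace.single i 1)) ∧
    ∫ y, ∑ i : Fin n, fderiv ℝ g y (EuclideanSpace.single i 1) *
        fderiv ℝ u y (EuclideanSpace.single i 1) = -∫ y, g y * lapl n u y := by
  let e : Fin n → EuclideanSpace ℝ (Fin n) := fun i => EuclideanSpace.single i 1
  have hpart : ∀ i, LipschitzOnWith L (fun y => fderiv ℝ u y (e i)) s := fun i =>
    LipschitzOnWith.of_dist_le_mul fun y hy z hz => by
      rw [dist_eq_norm, ← sub_apply]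
      have h1 := (fderiv ℝ u y - fderiv ℝ u z).le_opNorm (e i)
      have h2 := hu.dist_le_mul y hy z hz
      rw [dist_eq_norm] at h2
      simpa [e] using h1.trans (by simpa [e] using h2)
  choose h hlip heq using fun i => (hpart i).extend_real
  obtain ⟨D, hD⟩ := hg.lipschitzWith_of_hasCompactSupport hgc one_ne_zero
  have hg' : Continuous fun y => fderiv ℝ g y := hg.continuous_fderiv one_ne_zero
  have hsupp : ∀ y, y ∉ s → fderiv ℝ g y = 0 := fun y hy => by
    by_contra hne
    exact hy (hgs (support_fderiv_subset ℝ hne))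
  have hint1 : ∀ i, Integrable fun y => lineDeriv ℝ (h i) y (e i) * g y := fun i =>
    ((hlip i).locallyIntegrable_lineDeriv (e i)).integrable_smul_right_of_hasCompactSupport
      hg.continuous hgc
  have hint2 : ∀ i, Integrable fun y => fderiv ℝ g y (e i) * h i y := fun i =>
    Continuous.integrable_of_hasCompactSupport
      ((hg'.clm_apply continuous_const).mul (hlip i).continuous)
      ((hgc.fderiv_apply ℝ (e i)).mul_right)
  have hae : (fun y => g y * lapl n u y) =ᵐ[volume]
      fun y => ∑ i, lineDeriv ℝ (h i) y (e i) * g y := by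
    have hdiff : ∀ᵐ y, ∀ i, DifferentiableAt ℝ (h i) y :=
      ae_all_iff.2 fun i => (hlip i).ae_differentiableAt
    filter_upwards [hdiff] with y hy
    by_cases hys : y ∈ s
    · rw [lapl, Finset.mul_sum]
      refine Finset.sum_congr rfl fun i _ => ?_
      have hev : (fun z => fderiv ℝ u z (e i)) =ᶠ[nhds y] h i :=
        Filter.eventuallyEq_of_mem (hs.mem_nhds hys) (heq i)
      rw [(hy i).lineDeriv_eq_fderiv, ← hev.fderiv_eq, mul_comm]
    · have : g y = 0 := image_eq_zero_of_notMem_tsupport fun hc => hys (hgs hc)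
      simp [this]
  have heq2 : (fun y => ∑ i : Fin n, fderiv ℝ g y (e i) * fderiv ℝ u y (e i)) =
      fun y => ∑ i, fderiv ℝ g y (e i) * h i y := by
    funext y
    by_cases hys : y ∈ s
    · exact Finset.sum_congr rfl fun i _ => by rw [← heq i hys]
    · simp [hsupp y hys]
  refine ⟨(integrable_finsetSum _ fun i _ => hint1 i).congr hae.symm, ?_, ?_⟩
  · change Integrable fun y => ∑ i : Fin n, fderiv ℝ g y (e i) * fderiv ℝ u y (e i)
    rw [heq2]
    exact integrable_finsetSum _ fun i _ => hint2 i
  · change ∫ y, ∑ i : Fin n, fderiv ℝ g y (e i) * fderiv ℝ u y (e i) = _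
    rw [integral_congr_ae hae, heq2, integral_finsetSum _ fun i _ => hint1 i,
      integral_finsetSum _ fun i _ => hint2 i, ← Finset.sum_neg_distrib]
    refine Finset.sum_congr rfl fun i _ => ?_
    rw [(hlip i).integral_lineDeriv_mul_eq hD hgc (e i), ← integral_neg]
    refine integral_congr_ae (.of_forall fun y => ?_)
    have := (hg.differentiable one_ne_zero y).lineDeriv_eq_fderiv (v := -e i)
    simp [this]

/-- **Caccioppoli inequality** for functions with Lipschitz gradient and a one-sided bound on
`u Δu`. -/
theorem caccioppoli (n : ℕ) :
    ∃ G : ℝ, 0 ≤ G ∧ ∀ (x : EuclideanSpace ℝ (Fin n)) (σ : ℝ), 0 < σ →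
      ∀ (u : EuclideanSpace ℝ (Fin n) → ℝ) (L : NNReal) (A D : ℝ), 0 ≤ D →
      ContDiffOn ℝ 1 u (ball x (3 * σ)) →
      LipschitzOnWith L (fun y => fderiv ℝ u y) (ball x (3 * σ)) →
      (∀ y ∈ ball x (3 * σ), |u y| ≤ A) →
      (∀ᵐ y, y ∈ ball x (3 * σ) → -(u y * lapl n u y) ≤ D) →
      ∫ y in ball x σ, ‖gradient u y‖ ^ 2 ≤
        (2 * D + G * A ^ 2 / σ ^ 2) * volume.real (ball x (3 * σ)) := by
  obtain ⟨G, hG0, hG⟩ := exists_cutoff n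
  refine ⟨4 * n * G ^ 2, by positivity, ?_⟩
  intro x σ hσ u L A D hD hu hL hA hlap
  obtain ⟨η, hη, hηs, hη1, hη01, hηd⟩ := hG x σ hσ
  let B := ball x (3 * σ)
  have hηB : tsupport η ⊆ B := hηs.trans (closedBall_subset_ball (by linarith))
  have hηc : HasCompactSupport η := HasCompactSupport.of_support_subset_isCompact
    (isCompact_closedBall x (2 * σ)) ((subset_tsupport η).trans hηs)
  have hη0 : ∀ y, y ∉ B → η y = 0 := fun y hy =>
    image_eq_zero_of_notMem_tsupport fun hc => hy (hηB hc)
  let g : EuclideanSpace ℝ (Fin n) → ℝ := fun y => η y ^ 2 * u y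
  have hgsub : tsupport g ⊆ tsupport η := by
    refine closure_mono fun y hy => ?_
    intro h0
    exact hy (by simp [g, h0])
  have hg : ContDiff ℝ 1 g := by
    refine contDiff_of_contDiffOn_union_of_isOpen (s := B) (t := (tsupport g)ᶜ)
      ((hη.contDiffOn.pow 2).mul hu) ?_ ?_ isOpen_ball (isClosed_tsupport g).isOpen_compl
    · refine (contDiffOn_const (c := (0 : ℝ))).congr fun y hy => ?_
      exact image_eq_zero_of_notMem_tsupport hy
    · refine eq_univ_of_forall fun y => ?_
      by_cases hy : y ∈ tsupport g
      · exact Or.inl (hηB (hgsub hy))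
      · exact Or.inr hy
  have hgc : HasCompactSupport g := hηc.mono fun y hy h0 => hy (by simp [g, h0])
  obtain ⟨hi1, hi2, hibp⟩ := integral_mul_lapl n isOpen_ball hL hg hgc (hgsub.trans hηB)
  let E₀ : ℝ := n * (A ^ 2 * (G / σ) ^ 2)
  have hBfin : volume B ≠ ⊤ := measure_ball_lt_top.ne
  have hBi : ∀ c : ℝ, Integrable (B.indicator fun _ => c) := fun c =>
    (integrable_indicator_iff measurableSet_ball).2 (integrableOn_const hBfin)
  have hpt : ∀ y ∈ B, η y ^ 2 * ‖gradient u y‖ ^ 2 / 2 ≤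
      (∑ i : Fin n, fderiv ℝ g y (EuclideanSpace.single i 1) *
        fderiv ℝ u y (EuclideanSpace.single i 1)) + 2 * E₀ := by
    intro y hy
    have hud : DifferentiableAt ℝ u y :=
      (hu.differentiableOn one_ne_zero).differentiableAt (isOpen_ball.mem_nhds hy)
    have hηy : DifferentiableAt ℝ η y := hη.differentiable one_ne_zero y
    have hgd : ∀ v, fderiv ℝ g y v =
        η y ^ 2 * fderiv ℝ u y v + u y * (2 * η y * fderiv ℝ η y v) := fun v => by
      have := ((hηy.hasFDerivAt.pow 2).mul hud.hasFDerivAt).fderiv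
      have h2 : fderiv ℝ g y = _ := this
      rw [h2]
      simp
    have hE : 2 * E₀ = ∑ _i : Fin n, 2 * (A ^ 2 * (G / σ) ^ 2) := by
      simp [E₀]; ring
    rw [norm_gradient_sq, hE, ← Finset.sum_add_distrib, Finset.mul_sum, Finset.sum_div]
    refine Finset.sum_le_sum fun i _ => ?_
    rw [hgd]
    set a := fderiv ℝ u y (EuclideanSpace.single i 1)
    have hb := hηd y (EuclideanSpace.single i 1)
    set b := fderiv ℝ η y (EuclideanSpace.single i 1)
    rw [PiLp.norm_single, norm_one, mul_one] at hb
    have hub : (u y * b) ^ 2 ≤ A ^ 2 * (G / σ) ^ 2 := by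
      rw [← mul_pow]
      refine sq_le_sq' ?_ ?_ <;> [refine (abs_le.1 ?_).1; refine (abs_le.1 ?_).2] <;>
      · rw [abs_mul]
        exact mul_le_mul (hA y hy) hb (abs_nonneg _) ((abs_nonneg _).trans (hA y hy))
    nlinarith [sq_nonneg (η y * a + 2 * (u y * b))]
  have hgrad : ContinuousOn (fun y => ‖gradient u y‖ ^ 2) B :=
    (((InnerProductSpace.toDual ℝ (EuclideanSpace ℝ (Fin n))).symm.continuous.comp_continuousOn
      hL.continuousOn).norm).pow 2
  have hsub : ball x σ ⊆ B := ball_subset_ball (by linarith)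
  have hgi : IntegrableOn (fun y => ‖gradient u y‖ ^ 2) (ball x σ) :=
    ((hgrad.mono (closedBall_subset_ball (by linarith))).integrableOn_compact
      (isCompact_closedBall x σ)).mono_set ball_subset_closedBall
  have hfirst : ∫ y in ball x σ, ‖gradient u y‖ ^ 2 / 2 ≤
      (∫ y, ∑ i : Fin n, fderiv ℝ g y (EuclideanSpace.single i 1) *
        fderiv ℝ u y (EuclideanSpace.single i 1)) + 2 * E₀ * volume.real B := by
    have hc : ∫ y, B.indicator (fun _ => 2 * E₀) y = 2 * E₀ * volume.real B := by
      rw [integral_indicator measurableSet_ball, setIntegral_const, smul_eq_mul, mul_comm]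
    rw [← hc, ← integral_add hi2 (hBi _), ← integral_indicator measurableSet_ball]
    refine integral_mono ((integrable_indicator_iff measurableSet_ball).2 (hgi.div_const 2))
      (hi2.add (hBi _)) fun y => ?_
    by_cases hyB : y ∈ B
    · have h := hpt y hyB
      simp only [indicator_of_mem hyB]
      by_cases hy : y ∈ ball x σ
      · rw [indicator_of_mem hy]
        rw [hη1 y hy] at h
        simpa using h
      · rw [indicator_of_notMem hy]
        exact le_trans (by positivity) h
    · have h0 : fderiv ℝ g y = 0 := by
        by_contra hne
        exact hyB (hηB (hgsub (support_fderiv_subset ℝ hne)))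
      rw [indicator_of_notMem fun hy => hyB (hsub hy)]
      simp [indicator_of_notMem hyB, h0]
  have hsecond : -∫ y, g y * lapl n u y ≤ D * volume.real B := by
    have hc : ∫ y, B.indicator (fun _ => D) y = D * volume.real B := by
      rw [integral_indicator measurableSet_ball, setIntegral_const, smul_eq_mul, mul_comm]
    rw [← hc, ← integral_neg]
    refine integral_mono_ae hi1.neg (hBi _) ?_
    filter_upwards [hlap] with y hy
    by_cases hyB : y ∈ B
    · have h := hy hyB
      rw [indicator_of_mem hyB]
      have h1 : η y ^ 2 ≤ 1 := pow_le_one₀ (hη01 y).1 (hη01 y).2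
      have h2 : η y ^ 2 * -(u y * lapl n u y) ≤ η y ^ 2 * D :=
        mul_le_mul_of_nonneg_left h (sq_nonneg _)
      have h3 : η y ^ 2 * D ≤ D := mul_le_of_le_one_left hD h1
      simp only [g]
      linarith
    · simp [g, hη0 y hyB, indicator_of_notMem hyB]
  rw [integral_div] at hfirst
  have hE : 4 * E₀ = 4 * n * G ^ 2 * A ^ 2 / σ ^ 2 := by
    simp only [E₀]
    field_simp
  rw [← hE]
  linarith [hfirst, hsecond, hibp]

/-- Caccioppoli's inequality at the natural scaling `|u| ≲ σ²`, in averaged form. -/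
theorem average_gradient_sq_le (n : ℕ) {A D : ℝ} (hD : 0 ≤ D) :
    ∃ S : ℝ, 0 ≤ S ∧ ∀ (x : EuclideanSpace ℝ (Fin n)) (σ : ℝ), 0 < σ →
      ∀ (u : EuclideanSpace ℝ (Fin n) → ℝ) (L : NNReal),
      ContDiffOn ℝ 1 u (ball x (3 * σ)) →
      LipschitzOnWith L (fun y => fderiv ℝ u y) (ball x (3 * σ)) →
      (∀ y ∈ ball x (3 * σ), |u y| ≤ A * σ ^ 2) →
      (∀ᵐ y, y ∈ ball x (3 * σ) → -(u y * lapl n u y) ≤ D * σ ^ 2) →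
      ⨍ y in ball x σ, ‖gradient u y‖ ^ 2 ≤ S * σ ^ 2 := by
  obtain ⟨G, hG0, hG⟩ := caccioppoli n
  refine ⟨(2 * D + G * A ^ 2) * 3 ^ n, by positivity, ?_⟩
  intro x σ hσ u L hu hL hA hlap
  have h := hG x σ hσ u L (A * σ ^ 2) (D * σ ^ 2) (by positivity) hu hL hA hlap
  have hV : volume.real (ball x (3 * σ)) = 3 ^ n * volume.real (ball x σ) := by
    rw [Measure.real, Measure.addHaar_ball_mul_of_pos volume x three_pos σ, ENNReal.toReal_mul,
      ENNReal.toReal_ofReal (by positivity), finrank_euclideanSpace_fin,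
      ← Measure.real, Measure.addHaar_real_ball_center volume x]
  have hpos : 0 < volume.real (ball x σ) :=
    ENNReal.toReal_pos (measure_ball_pos volume x hσ).ne' measure_ball_lt_top.ne
  rw [setAverage_eq, smul_eq_mul, inv_mul_le_iff₀ hpos]
  refine h.trans_eq ?_
  rw [hV]
  field_simp

/-- **Gradient convergence (Section 5).**  There is `C = C(n, λ, M, K) > 0` such that
under the sandwich estimate (a), harmonicity of `w_ε - w₀` off the contact sets (b),
the `C^{1,1}`-type bounds on `w₀` and the vanishing of `w₀, ∇w₀` on `Λ₀` (c), the
Hausdorff closeness of the contact sets (d), and the Laplacian bounds on `w_ε` (e),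
one has `(⨍_{B_σ(x)} |∇w₀ - ∇w_ε|²)^{1/2} ≤ Cσ` whenever `cl(B_{3σ}(x)) ⊆ U`. -/
theorem gradient_convergence (n : ℕ) (lam M K : ℝ) (hlam : lam ∈ Set.Ioc (0:ℝ) 1)
    (hM : 1 ≤ M) (hK : 1 ≤ K) :
    ∃ C > 0, ∀ U : Set (EuclideanSpace ℝ (Fin n)), IsOpen U →
      ∀ σ ∈ Set.Ioc (0:ℝ) 1,
      ∀ Λ₀ Λε : Set (EuclideanSpace ℝ (Fin n)),
        Λ₀ ⊆ U → closure Λ₀ ∩ U ⊆ Λ₀ → Λε ⊆ U → closure Λε ∩ U ⊆ Λε →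
      ∀ w₀ wε : EuclideanSpace ℝ (Fin n) → ℝ, ∀ L₀ Lε : NNReal,
        ContDiffOn ℝ 1 w₀ U → LipschitzOnWith L₀ (fun y => fderiv ℝ w₀ y) U →
        ContDiffOn ℝ 1 wε U → LipschitzOnWith Lε (fun y => fderiv ℝ wε y) U →
        -- (a) sandwich estimate
        (∀ x ∈ U, w₀ x - σ ^ 2 ≤ wε x ∧ wε x ≤ w₀ x) →
        -- (b) harmonicity of `wε - w₀` off the contact sets
        ContDiffOn ℝ 2 (fun y => wε y - w₀ y) (U \ (Λ₀ ∪ Λε)) →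
        (∀ x ∈ U \ (Λ₀ ∪ Λε), lapl n (fun y => wε y - w₀ y) x = 0) →
        -- (c) regularity and vanishing of `w₀` on `Λ₀`
        (∀ x ∈ U, 0 ≤ w₀ x) →
        (∀ x ∈ Λ₀, w₀ x = 0 ∧ gradient w₀ x = 0) →
        (∀ y ∈ U, ∀ z ∈ Λ₀, w₀ y ≤ M * dist y z ^ 2 ∧ ‖gradient w₀ y‖ ≤ M * dist y z) →
        -- (d) contact sets within `Kσ` of `Λ₀`
        (∀ y ∈ Λ₀ ∪ Λε, ∃ z ∈ Λ₀, dist y z ≤ K * σ) →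
        -- (e) bounds on `wε` and its Laplacian
        (∀ x ∈ U, -σ ^ 2 ≤ wε x) →
        (∀ᵐ y : EuclideanSpace ℝ (Fin n), y ∈ U → lapl n wε y ≤ lam⁻¹) →
        (∀ᵐ y : EuclideanSpace ℝ (Fin n), y ∈ U ∧ 0 < wε y → 0 ≤ lapl n wε y) →
      ∀ x ∈ U, closedBall x (3 * σ) ⊆ U →
        Real.sqrt (⨍ y in ball x σ, ‖gradient w₀ y - gradient wε y‖ ^ 2) ≤ C * σ := by
  have hlam' : 0 ≤ lam⁻¹ := (inv_pos.2 hlam.1).le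
  obtain ⟨S, hS0, hS⟩ := average_gradient_sq_le n (A := M * (K + 6) ^ 2) hlam'
  have hA1 : 1 ≤ M * (K + 6) ^ 2 := by nlinarith
  refine ⟨Real.sqrt (2 * (M * (K + 6)) ^ 2 + 2 * S), by positivity, ?_⟩
  intro U hU σ hσ Λ₀ Λε _ _ _ _ w₀ wε L₀ Lε hw₀ hL₀ hwε hLε ha _ hharm _ _ hreg hdist
    hlow hup hsub x _ hxU
  obtain ⟨hσ0, -⟩ := hσ
  have hB : ball x (3 * σ) ⊆ U := ball_subset_closedBall.trans hxU
  have hb : ball x σ ⊆ ball x (3 * σ) := ball_subset_ball (by linarith)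
  have hd₀ : ∀ y ∈ U, DifferentiableAt ℝ w₀ y := fun y hy =>
    (hw₀.differentiableOn one_ne_zero).differentiableAt (hU.mem_nhds hy)
  have hdε : ∀ y ∈ U, DifferentiableAt ℝ wε y := fun y hy =>
    (hwε.differentiableOn one_ne_zero).differentiableAt (hU.mem_nhds hy)
  suffices h : ⨍ y in ball x σ, ‖gradient w₀ y - gradient wε y‖ ^ 2 ≤
      (2 * (M * (K + 6)) ^ 2 + 2 * S) * σ ^ 2 by
    refine (Real.sqrt_le_sqrt h).trans_eq ?_
    rw [Real.sqrt_mul (by positivity), Real.sqrt_sq hσ0.le]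
  by_cases hcase : ∃ p ∈ ball x (3 * σ), p ∈ Λ₀ ∪ Λε
  · obtain ⟨p, hpx, hpΛ⟩ := hcase
    obtain ⟨z, hz, hpz⟩ := hdist p hpΛ
    have hyz : ∀ y ∈ ball x (3 * σ), dist y z ≤ (K + 6) * σ := fun y hy => by
      rw [mem_ball] at hpx hy
      have h1 := dist_triangle y x z
      have h2 := dist_triangle x p z
      rw [dist_comm x p] at h2
      linarith
    have hbound : ∀ y ∈ ball x (3 * σ), w₀ y ≤ M * (K + 6) ^ 2 * σ ^ 2 := fun y hy => by
      refine (hreg y (hB hy) z hz).1.trans ?_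
      rw [mul_assoc, ← mul_pow]
      gcongr
      exact hyz y hy
    have havg := hS x σ hσ0 wε Lε (hwε.mono hB) (hLε.mono hB) ?_ ?_
    · have hcont : ∀ {w : EuclideanSpace ℝ (Fin n) → ℝ} {L : NNReal},
          LipschitzOnWith L (fun y => fderiv ℝ w y) U →
          ContinuousOn (fun y => gradient w y) (closedBall x σ) := fun hL =>
        ((InnerProductSpace.toDual ℝ
          (EuclideanSpace ℝ (Fin n))).symm.continuous.comp_continuousOn hL.continuousOn).mono
          ((closedBall_subset_closedBall (by linarith)).trans hxU)
      have hcompact := isCompact_closedBall x σ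
      have hi1 : IntegrableOn (fun y => ‖gradient w₀ y - gradient wε y‖ ^ 2) (ball x σ) :=
        ((((hcont hL₀).sub (hcont hLε)).norm.pow 2).integrableOn_compact hcompact).mono_set
          ball_subset_closedBall
      have hi2 : IntegrableOn (fun y => ‖gradient wε y‖ ^ 2) (ball x σ) :=
        (((hcont hLε).norm.pow 2).integrableOn_compact hcompact).mono_set ball_subset_closedBall
      have hi3 : IntegrableOn (fun _ => 2 * (M * (K + 6)) ^ 2 * σ ^ 2) (ball x σ) :=
        integrableOn_const measure_ball_lt_top.ne
      have hpos : 0 < volume.real (ball x σ) :=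
        ENNReal.toReal_pos (measure_ball_pos volume x hσ0).ne' measure_ball_lt_top.ne
      have hmono : ∫ y in ball x σ, ‖gradient w₀ y - gradient wε y‖ ^ 2 ≤
          ∫ y in ball x σ, (2 * (M * (K + 6)) ^ 2 * σ ^ 2 + 2 * ‖gradient wε y‖ ^ 2) := by
        refine setIntegral_mono_on hi1 (hi3.add (hi2.const_mul 2)) measurableSet_ball fun y hy => ?_
        have h1 : ‖gradient w₀ y‖ ≤ M * ((K + 6) * σ) :=
          (hreg y (hB (hb hy)) z hz).2.trans (by gcongr; exact hyz y (hb hy))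
        have h2 : ‖gradient w₀ y - gradient wε y‖ ≤ M * ((K + 6) * σ) + ‖gradient wε y‖ :=
          (norm_sub_le _ _).trans (by gcongr)
        calc ‖gradient w₀ y - gradient wε y‖ ^ 2
            ≤ (M * ((K + 6) * σ) + ‖gradient wε y‖) ^ 2 := by gcongr
          _ ≤ _ := by nlinarith [sq_nonneg (M * ((K + 6) * σ) - ‖gradient wε y‖)]
      rw [integral_add hi3 (hi2.const_mul 2), setIntegral_const, integral_const_mul,
        smul_eq_mul] at hmono
      rw [setAverage_eq, smul_eq_mul, inv_mul_le_iff₀ hpos] at havg ⊢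
      linarith
    · intro y hy
      have h1 := (ha y (hB hy)).2
      have h2 := hlow y (hB hy)
      have h3 := hbound y hy
      rw [abs_le]
      constructor <;> nlinarith [sq_nonneg σ]
    · filter_upwards [hup, hsub] with y h1 h2 hy
      rcases lt_or_ge 0 (wε y) with hpos | hneg
      · have := mul_nonneg hpos.le (h2 ⟨hB hy, hpos⟩)
        have : 0 ≤ lam⁻¹ * σ ^ 2 := by positivity
        linarith
      · have h3 := mul_le_mul_of_nonneg_left (h1 (hB hy)) (neg_nonneg.2 hneg)
        have h4 := mul_le_mul_of_nonneg_right (hlow y (hB hy)) hlam'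
        linarith
  · push Not at hcase
    have hfd : EqOn (fun y => fderiv ℝ (fun z => wε z - w₀ z) y)
        (fun y => fderiv ℝ wε y - fderiv ℝ w₀ y) U := fun y hy =>
      fderiv_fun_sub (hdε y hy) (hd₀ y hy)
    have hLip : LipschitzOnWith (Lε + L₀) (fun y => fderiv ℝ (fun z => wε z - w₀ z) y) U :=
      fun y hy z hz => by
        simpa only [hfd hy, hfd hz] using (hLε.sub hL₀) hy hz
    have havg := hS x σ hσ0 (fun y => wε y - w₀ y) (Lε + L₀) ((hwε.sub hw₀).mono hB)
      (hLip.mono hB) ?_ ?_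
    · have heq : ⨍ y in ball x σ, ‖gradient w₀ y - gradient wε y‖ ^ 2 =
          ⨍ y in ball x σ, ‖gradient (fun z => wε z - w₀ z) y‖ ^ 2 := by
        rw [setAverage_eq, setAverage_eq]
        congr 1
        refine setIntegral_congr_fun measurableSet_ball fun y hy => ?_
        have : gradient (fun z => wε z - w₀ z) y = gradient wε y - gradient w₀ y := by
          simp only [gradient]
          rw [fderiv_fun_sub (hdε y (hB (hb hy))) (hd₀ y (hB (hb hy))), map_sub]
        simp only [this, norm_sub_rev]
      rw [heq]
      refine havg.trans ?_
      gcongr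
      nlinarith [sq_nonneg (M * (K + 6))]
    · intro y hy
      obtain ⟨h1, h2⟩ := ha y (hB hy)
      rw [abs_le]
      constructor <;> nlinarith [sq_nonneg σ]
    · refine .of_forall fun y hy => ?_
      rw [hharm y ⟨hB hy, hcase y hy⟩, mul_zero, neg_zero]
      positivity
end
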